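/- Let D be a probability distribution on ℝ^d × {1,…,k}, let n ≥ 1, δ ∈ (0,1), and η > 0. Consider the class H of convolutional neural networks h_C described below with weight bounds (aᵢ), (sᵢ) and complexity R_C. Then the D^n-outer probability of the set of samples S = ((x₁,y₁),…,(x_n,y_n)) for which some h_C ∈ H violates the inequality D{(x,y) : h_C(x)_y ≤ max_{j≠y} h_C(x)_j} ≤ (1/n)Σ_{i=1}^{n} ℓ_η(h_C(xᵢ), yᵢ) + 32·(2‖X‖_F·R_C/η)^{1/4}·n^{−5/8} + 3·√(ln(1/δ)/(2n)), where ‖X‖_F = (Σᵢ‖xᵢ‖₂²)^{1/2}, is at most δ. -/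

import Mathlib

noncomputable def frobNorm {α β : Type*} [Fintype α] [Fintype β] (M : Matrix α β ℝ) : ℝ :=
  Real.sqrt (∑ i, ∑ j, (M i j) ^ 2)

noncomputable def specNorm {α β : Type*} [Fintype α] [Fintype β] [DecidableEq β]
    (M : Matrix α β ℝ) : ℝ :=
  ‖LinearMap.toContinuousLinearMap (Matrix.toEuclideanLin M)‖

/-- The fully connected matrix `γ(W)` built from a convolutional weight `W ∈ ℝ^{c×r}` via
`m` index maps `S k : Fin r → Fin d`. -/
noncomputable def gamma {c r d m : ℕ} (S : Fin m → Fin r → Fin d)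
    (W : Matrix (Fin c) (Fin r) ℝ) : Matrix (Fin c × Fin m) (Fin d) ℝ :=
  fun ik j => ∑ p, if S ik.2 p = j then W ik.1 p else 0

/-- The network `h_C(x)` evaluated layer by layer on a vector input. -/
noncomputable def netVec (d : ℕ → ℕ)
    (C : ∀ i : ℕ, Matrix (Fin (d (i+1))) (Fin (d i)) ℝ)
    (σ : ∀ i : ℕ, (Fin (d (i+1)) → ℝ) → (Fin (d (i+1)) → ℝ))
    (x : Fin (d 0) → ℝ) : (ℓ : ℕ) → (Fin (d ℓ) → ℝ)
  | 0 => x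
  | (ℓ+1) => σ ℓ ((C ℓ).mulVec (netVec d C σ x ℓ))

/-- `g_η(r) = 0` for `r < −η`, `1 + r/η` for `−η ≤ r ≤ 0`, `1` for `r > 0`. -/
noncomputable def rampFn (η r : ℝ) : ℝ := if r < -η then 0 else if r ≤ 0 then 1 + r / η else 1

/-- Ramp loss `ℓ_η(v,y) = g_η(−(v_y − max_{j≠y} v_j))`. -/
noncomputable def rampLoss {k : ℕ} (η : ℝ) (v : Fin k → ℝ) (y : Fin k) : ℝ :=
  rampFn η (-(v y - sSup (v '' {j | j ≠ y})))


theorem aux_sep_card {E : Type*} [NormedAddCommGroup E] [NormedSpace ℝ E] [FiniteDimensional ℝ E]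
    (a e : ℝ) (ha : 0 ≤ a) (he : 0 < e) (s : Finset E) (hs : ∀ c ∈ s, ‖c‖ ≤ a)
    (h : ∀ c ∈ s, ∀ d ∈ s, c ≠ d → e ≤ ‖c - d‖) :
    (s.card : ℝ) ≤ (1 + 2 * a / e) ^ (Module.finrank ℝ E) := by
  borelize E
  let μ : MeasureTheory.Measure E := MeasureTheory.Measure.addHaar
  let δ : ℝ := e / 2
  let ρ : ℝ := a + e / 2
  have δpos : 0 < δ := by positivity
  have ρpos : 0 < ρ := by positivity
  set A := ⋃ c ∈ s, Metric.ball (c : E) δ with hA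
  have D : Set.Pairwise (s : Set E) (Function.onFun Disjoint fun c => Metric.ball (c : E) δ) := by
    rintro c hc d hd hcd
    apply Metric.ball_disjoint_ball
    rw [dist_eq_norm]
    have := h c hc d hd hcd
    simp only [δ]; linarith
  have A_subset : A ⊆ Metric.ball (0 : E) ρ := by
    refine Set.iUnion₂_subset fun x hx => ?_
    apply Metric.ball_subset_ball'
    rw [dist_zero_right]
    have := hs x hx
    simp only [δ, ρ]; linarith
  have I : (s.card : ENNReal) * ENNReal.ofReal (δ ^ Module.finrank ℝ E) * μ (Metric.ball 0 1) ≤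
      ENNReal.ofReal (ρ ^ Module.finrank ℝ E) * μ (Metric.ball 0 1) :=
    calc
      (s.card : ENNReal) * ENNReal.ofReal (δ ^ Module.finrank ℝ E) * μ (Metric.ball 0 1) = μ A := by
        rw [hA, MeasureTheory.measure_biUnion_finset D fun c _ => measurableSet_ball]
        simp only [μ.addHaar_ball_of_pos _ δpos]
        simp only [Finset.sum_const, nsmul_eq_mul, mul_assoc]
      _ ≤ μ (Metric.ball (0 : E) ρ) := MeasureTheory.measure_mono A_subset
      _ = ENNReal.ofReal (ρ ^ Module.finrank ℝ E) * μ (Metric.ball 0 1) := by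
        simp only [μ.addHaar_ball_of_pos _ ρpos]
  have J : (s.card : ENNReal) * ENNReal.ofReal (δ ^ Module.finrank ℝ E) ≤
      ENNReal.ofReal (ρ ^ Module.finrank ℝ E) :=
    (ENNReal.mul_le_mul_iff_left (Metric.measure_ball_pos _ _ zero_lt_one).ne'
      MeasureTheory.measure_ball_lt_top.ne).1 I
  have K := ENNReal.toReal_le_of_le_ofReal (pow_nonneg ρpos.le _) J
  rw [ENNReal.toReal_mul, ENNReal.toReal_natCast, ENNReal.toReal_ofReal (by positivity)] at K
  have h3 : (1 + 2 * a / e) = ρ / δ := by simp only [ρ, δ]; field_simp; ring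
  rw [h3, div_pow, le_div_iff₀ (by positivity)]
  exact K

theorem aux_exists_net {E : Type*} [NormedAddCommGroup E] [NormedSpace ℝ E] [FiniteDimensional ℝ E]
    (a e κ : ℝ) (ha : 0 ≤ a) (he : 0 < e) (hκ : 0 ≤ κ) (A : Set E) (hA : ∀ x ∈ A, ‖x‖ ≤ a) :
    ∃ t : Finset E, (∀ x ∈ t, x ∈ A) ∧
      (t.card : ℝ) ≤ (1 + 2 * (a * κ) / e) ^ (Module.finrank ℝ E) ∧
      ∀ x ∈ A, ∃ y ∈ t, κ * ‖x - y‖ ≤ e := by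
  classical
  rcases hκ.eq_or_lt with rfl | hκ
  · rcases A.eq_empty_or_nonempty with rfl | ⟨x0, hx0⟩
    · exact ⟨∅, by simp, by simp, by simp⟩
    · exact ⟨{x0}, by simpa using hx0, by simp, fun x _ => ⟨x0, by simp, by simpa using he.le⟩⟩
  have hb : ∀ s : Finset E, ((∀ x ∈ s, x ∈ A) ∧ ∀ c ∈ s, ∀ d ∈ s, c ≠ d → e / κ ≤ ‖c - d‖) →
      (s.card : ℝ) ≤ (1 + 2 * (a * κ) / e) ^ (Module.finrank ℝ E) := by
    intro s hs
    have := aux_sep_card a (e / κ) ha (by positivity) s (fun c hc => hA c (hs.1 c hc)) hs.2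
    convert this using 3
    field_simp
  let P : ℕ → Prop := fun k => ∃ s : Finset E, ((∀ x ∈ s, x ∈ A) ∧
    ∀ c ∈ s, ∀ d ∈ s, c ≠ d → e / κ ≤ ‖c - d‖) ∧ s.card = k
  have hP0 : P 0 := ⟨∅, by simp, by simp⟩
  obtain ⟨N, hN⟩ := exists_nat_ge ((1 + 2 * (a * κ) / e) ^ (Module.finrank ℝ E))
  have hbd : ∀ k, P k → k ≤ N := by
    rintro k ⟨s, hs, rfl⟩
    exact_mod_cast (hb s hs).trans hN
  have hspec : P (Nat.findGreatest P N) := Nat.findGreatest_spec (Nat.zero_le N) hP0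
  obtain ⟨t, ht, hcard⟩ := hspec
  refine ⟨t, ht.1, hb t ht, fun x hx => ?_⟩
  by_contra! hcon
  have hxt : x ∉ t := fun hxt => by
    have := hcon x hxt
    simp at this; linarith
  have hP : P (t.card + 1) := by
    refine ⟨insert x t, ⟨?_, ?_⟩, Finset.card_insert_of_notMem hxt⟩
    · intro y hy
      rcases Finset.mem_insert.1 hy with rfl | hy
      · exact hx
      · exact ht.1 y hy
    · have hx' : ∀ y ∈ t, e / κ ≤ ‖x - y‖ := fun y hy => by
        rw [div_le_iff₀ hκ, mul_comm]; exact (hcon y hy).le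
      intro c hc d hd hcd
      rcases Finset.mem_insert.1 hc with hc1 | hc1 <;> rcases Finset.mem_insert.1 hd with hd1 | hd1
      · exact absurd (hc1.trans hd1.symm) hcd
      · rw [hc1]; exact hx' d hd1
      · rw [hd1, norm_sub_rev]; exact hx' c hc1
      · exact ht.2 c hc1 d hd1 hcd
  have := Nat.le_findGreatest (hbd _ hP) hP
  omega

noncomputable def sgn' (b : Bool) : ℝ := cond b 1 (-1)

noncomputable def rdot {n : ℕ} (ε : Fin n → Bool) (v : Fin n → ℝ) : ℝ := ∑ i, sgn' (ε i) * v i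

noncomputable def ravg {n : ℕ} (g : (Fin n → Bool) → ℝ) : ℝ := (∑ ε, g ε) / 2 ^ n

theorem ravg_mono {n : ℕ} {g h : (Fin n → Bool) → ℝ} (H : ∀ ε, g ε ≤ h ε) : ravg g ≤ ravg h := by
  unfold ravg
  have := Finset.sum_le_sum (fun ε (_ : ε ∈ Finset.univ) => H ε)
  gcongr

theorem ravg_add {n : ℕ} (g h : (Fin n → Bool) → ℝ) :
    ravg (fun ε => g ε + h ε) = ravg g + ravg h := by
  unfold ravg; rw [Finset.sum_add_distrib, add_div]

theorem ravg_const {n : ℕ} (c : ℝ) : ravg (fun _ : Fin n → Bool => c) = c := by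
  unfold ravg
  simp

theorem ravg_mul {n : ℕ} (c : ℝ) (g : (Fin n → Bool) → ℝ) :
    ravg (fun ε => c * g ε) = c * ravg g := by
  unfold ravg; rw [← Finset.mul_sum, mul_div_assoc]

theorem rdot_sub {n : ℕ} (ε : Fin n → Bool) (v w : Fin n → ℝ) :
    rdot ε (fun i => v i - w i) = rdot ε v - rdot ε w := by
  unfold rdot; rw [← Finset.sum_sub_distrib]; exact Finset.sum_congr rfl fun i _ => by ring

theorem sgn'_sq (b : Bool) : sgn' b ^ 2 = 1 := by cases b <;> simp [sgn']

theorem sgn'_abs (b : Bool) : |sgn' b| = 1 := by cases b <;> simp [sgn']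

theorem rdot_le {n : ℕ} (ε : Fin n → Bool) (v : Fin n → ℝ) (R : ℝ) (hR : 0 ≤ R)
    (h : ∑ i, v i ^ 2 ≤ R ^ 2) : rdot ε v ≤ Real.sqrt n * R := by
  have := Finset.sum_mul_sq_le_sq_mul_sq Finset.univ (fun i => sgn' (ε i)) v
  simp only [sgn'_sq] at this
  apply le_of_sq_le_sq _ (by positivity)
  rw [mul_pow, Real.sq_sqrt (by positivity)]
  unfold rdot
  refine this.trans ?_
  simp
  gcongr

theorem ravg_exp {n : ℕ} (v : Fin n → ℝ) (l : ℝ) :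
    ravg (fun ε => Real.exp (l * rdot ε v)) ≤ Real.exp (l ^ 2 * (∑ i, v i ^ 2) / 2) := by
  have h1 : ∀ ε : Fin n → Bool, Real.exp (l * rdot ε v) =
      ∏ i, Real.exp (l * (sgn' (ε i) * v i)) := by
    intro ε; rw [← Real.exp_sum, rdot, Finset.mul_sum]
  have h2 : ∑ ε : Fin n → Bool, ∏ i, Real.exp (l * (sgn' (ε i) * v i)) =
      ∏ i, ∑ b : Bool, Real.exp (l * (sgn' b * v i)) := by
    rw [Finset.prod_univ_sum, Fintype.piFinset_univ]
  unfold ravg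
  simp only [h1]
  rw [h2]
  have h3 : ∀ i, ∑ b : Bool, Real.exp (l * (sgn' b * v i)) = 2 * Real.cosh (l * v i) := by
    intro i; rw [Real.cosh_eq]; simp [sgn']; ring
  simp only [h3]
  rw [Finset.prod_mul_distrib]
  simp only [Finset.prod_const, Finset.card_univ, Fintype.card_fin]
  rw [mul_div_cancel_left₀ _ (by positivity), Finset.mul_sum, Finset.sum_div, Real.exp_sum]
  apply Finset.prod_le_prod
  · intro i _; exact (Real.cosh_pos _).le
  · intro i _
    refine (Real.cosh_le_exp_half_sq _).trans (le_of_eq ?_)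
    congr 1; ring

theorem ravg_jensen {n : ℕ} (g : (Fin n → Bool) → ℝ) :
    Real.exp (ravg g) ≤ ravg (fun ε => Real.exp (g ε)) := by
  have h : ∀ ε, Real.exp (ravg g) * (1 + (g ε - ravg g)) ≤ Real.exp (g ε) := by
    intro ε
    have := Real.add_one_le_exp (g ε - ravg g)
    calc _ ≤ Real.exp (ravg g) * Real.exp (g ε - ravg g) := by gcongr; linarith
      _ = _ := by rw [← Real.exp_add]; congr 1; ring
  refine le_trans (le_of_eq ?_) (ravg_mono h)
  rw [ravg_mul]
  have : ravg (fun ε => 1 + (g ε - ravg g)) = ravg (fun ε => (1 - ravg g) + g ε) := by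
    congr 1; ext ε; ring
  rw [this, ravg_add, ravg_const]; ring

theorem massart {n : ℕ} {ι : Type*} (T : Finset ι) (hT : T.Nonempty) (w : ι → Fin n → ℝ)
    (R l : ℝ) (hR : 0 < R) (hw : ∀ t ∈ T, ∑ i, w t i ^ 2 ≤ R ^ 2) (hl : Real.log T.card ≤ l) :
    ravg (fun ε => T.sup' hT (fun t => rdot ε (w t))) ≤ R * Real.sqrt (2 * l) := by
  have hl0 : 0 ≤ l := (Real.log_natCast_nonneg _).trans hl
  have key : ∀ x : ℝ, 0 < x →
      x * ravg (fun ε => T.sup' hT (fun t => rdot ε (w t))) ≤ l + x ^ 2 * R ^ 2 / 2 := by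
    intro x hx
    rw [← Real.exp_le_exp, ← ravg_mul]
    refine (ravg_jensen _).trans ?_
    have h1 : ∀ ε : Fin n → Bool, Real.exp (x * T.sup' hT (fun t => rdot ε (w t))) ≤
        ∑ t ∈ T, Real.exp (x * rdot ε (w t)) := by
      intro ε
      obtain ⟨t, ht, h⟩ := Finset.exists_mem_eq_sup' hT (fun t => rdot ε (w t))
      rw [h]
      exact Finset.single_le_sum (f := fun t => Real.exp (x * rdot ε (w t)))
        (fun i _ => (Real.exp_pos _).le) ht
    refine (ravg_mono h1).trans ?_
    have h2 : ravg (fun ε => ∑ t ∈ T, Real.exp (x * rdot ε (w t))) =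
        ∑ t ∈ T, ravg (fun ε => Real.exp (x * rdot ε (w t))) := by
      unfold ravg; rw [Finset.sum_comm, Finset.sum_div]
    rw [h2]
    calc _ ≤ ∑ t ∈ T, Real.exp (x ^ 2 * R ^ 2 / 2) := by
          apply Finset.sum_le_sum
          intro t ht
          refine (ravg_exp _ _).trans ?_
          have := hw t ht
          gcongr
      _ = (T.card : ℝ) * Real.exp (x ^ 2 * R ^ 2 / 2) := by simp
      _ ≤ Real.exp l * Real.exp (x ^ 2 * R ^ 2 / 2) := by
          gcongr
          rw [← Real.log_le_iff_le_exp]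
          · exact hl
          · exact_mod_cast hT.card_pos
      _ = _ := by rw [← Real.exp_add]
  set M := ravg (fun ε => T.sup' hT (fun t => rdot ε (w t)))
  rcases hl0.eq_or_lt with h0 | h0
  · rw [← h0]; simp
    by_contra! hM
    have := key (M / R ^ 2) (by positivity)
    rw [← h0] at this
    have h5 : M / R ^ 2 * M = M ^ 2 / R ^ 2 := by ring
    have h6 : (M / R ^ 2) ^ 2 * R ^ 2 / 2 = (M ^ 2 / R ^ 2) / 2 := by field_simp
    rw [h5, h6] at this
    have : 0 < M ^ 2 / R ^ 2 := by positivity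
    linarith
  · have hs : 0 < Real.sqrt (2 * l) := by positivity
    have := key (Real.sqrt (2 * l) / R) (by positivity)
    have h5 := Real.sq_sqrt (show 0 ≤ 2 * l by positivity)
    rw [div_pow, h5] at this
    have h6 : l + 2 * l / R ^ 2 * R ^ 2 / 2 = 2 * l := by field_simp; ring
    rw [h6, ← h5, div_mul_eq_mul_div, div_le_iff₀ hR] at this
    have h7 : Real.sqrt (2 * l) * M ≤ Real.sqrt (2 * l) * (R * Real.sqrt (2 * l)) := by
      rw [h5] at this; nlinarith
    exact le_of_mul_le_mul_left h7 hs

theorem chain_step {n : ℕ} (T T' : Finset (Fin n → ℝ)) (hT : T.Nonempty) (hT' : T'.Nonempty)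
    (R l : ℝ) (hR : 0 < R) (hw : ∀ t ∈ T, ∃ t' ∈ T', ∑ i, (t i - t' i) ^ 2 ≤ R ^ 2)
    (hl : Real.log T.card ≤ l) :
    ravg (fun ε => T.sup' hT (fun t => rdot ε t)) ≤
      ravg (fun ε => T'.sup' hT' (fun t => rdot ε t)) + R * Real.sqrt (2 * l) := by
  have : ∀ t, ∃ t' : Fin n → ℝ, t ∈ T → t' ∈ T' ∧ ∑ i, (t i - t' i) ^ 2 ≤ R ^ 2 := by
    intro t
    by_cases ht : t ∈ T
    · obtain ⟨t', h1, h2⟩ := hw t ht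
      exact ⟨t', fun _ => ⟨h1, h2⟩⟩
    · exact ⟨0, fun h => absurd h ht⟩
  choose p hp using this
  have hm := massart T hT (fun t i => t i - p t i) R l hR (fun t ht => (hp t ht).2) hl
  refine le_trans ?_ (add_le_add le_rfl hm)
  rw [← ravg_add]
  apply ravg_mono
  intro ε
  apply Finset.sup'_le
  intro t ht
  have h1 := Finset.le_sup' (fun t => rdot ε t) (hp t ht).1
  have h2 := Finset.le_sup' (fun t => rdot ε (fun i => t i - p t i)) ht
  simp only [rdot_sub] at h2 ⊢
  linarith

theorem dudley {n : ℕ} (hn : 1 ≤ n) (V : Set (Fin n → ℝ)) (hV : V.Nonempty)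
    (hV01 : ∀ v ∈ V, ∀ i, 0 ≤ v i ∧ v i ≤ 1) (K : ℝ) (hK : 0 ≤ K)
    (hcov : ∀ e : ℝ, 0 < e → ∃ T : Finset (Fin n → ℝ), (∀ t ∈ T, t ∈ V) ∧
      Real.log T.card ≤ Real.sqrt (K / e) ∧ ∀ v ∈ V, ∃ t ∈ T, ∑ i, (v i - t i) ^ 2 ≤ e ^ 2) :
    ravg (fun ε => sSup (rdot ε '' V)) ≤ 16 * (K ^ ((1 : ℝ) / 4) * (n : ℝ) ^ ((3 : ℝ) / 8)) := by
  obtain ⟨v0, hv0⟩ := hV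
  have hn0 : (0 : ℝ) < n := by exact_mod_cast hn
  set s := Real.sqrt n with hs
  have hspos : 0 < s := by positivity
  have hssq : s ^ 2 = n := Real.sq_sqrt hn0.le
  set A := K ^ ((1 : ℝ) / 4) * (n : ℝ) ^ ((3 : ℝ) / 8) with hA
  have hA0 : 0 ≤ A := by positivity
  set q : ℝ := (2 : ℝ) ^ (-(3 : ℝ) / 4) with hq
  have hq0 : 0 < q := by positivity
  have hq4 : q ^ 4 = 1 / 8 := by
    rw [hq, ← Real.rpow_natCast, ← Real.rpow_mul (by norm_num)]
    norm_num
  have hq23 : q ≤ 2 / 3 := by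
    by_contra! h
    have : (2 / 3 : ℝ) ^ 4 < q ^ 4 := by gcongr
    rw [hq4] at this; norm_num at this
  have hpow : ∀ j : ℕ, ∃ T : Finset (Fin n → ℝ), ∃ hT : T.Nonempty, (∀ t ∈ T, t ∈ V) ∧
      (∀ v ∈ V, ∃ t ∈ T, ∑ i, (v i - t i) ^ 2 ≤ (s / 2 ^ j) ^ 2) ∧
      ravg (fun ε => T.sup' hT (fun t => rdot ε t)) ≤ 16 * A * (1 - q ^ j) := by
    intro j
    induction j with
    | zero =>
      refine ⟨{v0}, by simp, by simpa using hv0, ?_, ?_⟩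
      · intro v hv
        refine ⟨v0, by simp, ?_⟩
        simp only [pow_zero, div_one, hssq]
        calc ∑ i, (v i - v0 i) ^ 2 ≤ ∑ i : Fin n, (1 : ℝ) := by
              apply Finset.sum_le_sum
              intro i _
              have h1 := hV01 v hv i
              have h2 := hV01 v0 hv0 i
              rw [sq_le_one_iff_abs_le_one, abs_le]
              constructor <;> linarith
          _ = n := by simp
      · have := massart {v0} (by simp) (fun t => t) (s + 1 + ∑ i, v0 i ^ 2) 0
          (by have : 0 ≤ ∑ i, v0 i ^ 2 := Finset.sum_nonneg fun i _ => sq_nonneg _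
              positivity) ?_ (by simp)
        · simpa using this
        · simp only [Finset.mem_singleton, forall_eq]
          have : 0 ≤ ∑ i, v0 i ^ 2 := Finset.sum_nonneg fun i _ => sq_nonneg _
          nlinarith
    | succ j ih =>
      obtain ⟨T', hT', hT'V, hc', hb'⟩ := ih
      obtain ⟨T, hTV, hl, hc⟩ := hcov (s / 2 ^ (j + 1)) (by positivity)
      have hT : T.Nonempty := by
        obtain ⟨t, ht, _⟩ := hc v0 hv0
        exact ⟨t, ht⟩
      refine ⟨T, hT, hTV, hc, ?_⟩
      have hst := chain_step T T' hT hT' (s / 2 ^ j) _ (by positivity)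
        (fun t ht => hc' t (hTV t ht)) hl
      have hterm : s / 2 ^ j * Real.sqrt (2 * Real.sqrt (K / (s / 2 ^ (j + 1)))) =
          2 * Real.sqrt 2 * A * q ^ (j + 1) := by
        set u := s / 2 ^ (j + 1) with hu
        have hu0 : 0 < u := by positivity
        have h1 : s / 2 ^ j = 2 * u := by rw [hu, pow_succ]; field_simp
        have h2 : Real.sqrt (Real.sqrt (K / u)) = K ^ ((1 : ℝ) / 4) * u ^ (-(1 : ℝ) / 4) := by
          rw [Real.sqrt_eq_rpow, Real.sqrt_eq_rpow, ← Real.rpow_mul (by positivity),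
            Real.div_rpow hK hu0.le, div_eq_mul_inv, ← Real.rpow_neg hu0.le]
          norm_num
        have h3 : u * u ^ (-(1 : ℝ) / 4) = u ^ ((3 : ℝ) / 4) := by
          nth_rewrite 1 [← Real.rpow_one u]
          rw [← Real.rpow_add hu0]; norm_num
        have h4 : u ^ ((3 : ℝ) / 4) = (n : ℝ) ^ ((3 : ℝ) / 8) * q ^ (j + 1) := by
          rw [hu, Real.div_rpow hspos.le (by positivity), hs, Real.sqrt_eq_rpow,
            ← Real.rpow_mul hn0.le, div_eq_mul_inv, ← Real.rpow_neg (by positivity),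
            hq, ← Real.rpow_natCast, ← Real.rpow_natCast, ← Real.rpow_mul (by norm_num),
            ← Real.rpow_mul (by norm_num)]
          congr 2
          · norm_num
          · ring
        rw [Real.sqrt_mul (by norm_num), h2, h1, hA]
        calc _ = 2 * Real.sqrt 2 * K ^ ((1 : ℝ) / 4) * (u * u ^ (-(1 : ℝ) / 4)) := by ring
          _ = _ := by rw [h3, h4]; ring
      rw [hterm] at hst
      have h2 : Real.sqrt 2 ≤ 2 := by
        rw [Real.sqrt_le_left (by norm_num)]; norm_num
      have h3 : 2 * Real.sqrt 2 * A * q ^ (j + 1) ≤ 16 * A * (q ^ j - q ^ (j + 1)) := by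
        have : q ^ j - q ^ (j + 1) = q ^ j * (1 - q) := by ring
        rw [this, pow_succ]
        have h5 : 2 * Real.sqrt 2 * q ≤ 16 * (1 - q) := by nlinarith
        have h6 : 0 ≤ A * q ^ j := by positivity
        nlinarith
      linarith
  have hfin : ∀ j : ℕ, ravg (fun ε => sSup (rdot ε '' V)) ≤ 16 * A + n * (1 / 2) ^ j := by
    intro j
    obtain ⟨T, hT, hTV, hc, hb⟩ := hpow j
    have h1 : ravg (fun ε => sSup (rdot ε '' V)) ≤
        ravg (fun ε => T.sup' hT (fun t => rdot ε t) + n * (1 / 2) ^ j) := by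
      apply ravg_mono
      intro ε
      refine csSup_le (Set.Nonempty.image _ ⟨v0, hv0⟩) ?_
      rintro _ ⟨v, hv, rfl⟩
      obtain ⟨t, ht, hvt⟩ := hc v hv
      have h2 := rdot_le ε (fun i => v i - t i) (s / 2 ^ j) (by positivity) hvt
      rw [rdot_sub] at h2
      have h3 := Finset.le_sup' (fun t => rdot ε t) ht
      have h4 : Real.sqrt n * (s / 2 ^ j) = n * (1 / 2) ^ j := by
        rw [← hs, ← hssq]; field_simp; simp
      linarith
    rw [ravg_add, ravg_const] at h1
    have : 0 ≤ A * q ^ j := by positivity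
    linarith
  have hlim : Filter.Tendsto (fun j : ℕ => 16 * A + (n : ℝ) * (1 / 2) ^ j) Filter.atTop
      (nhds (16 * A + n * 0)) :=
    ((tendsto_pow_atTop_nhds_zero_of_lt_one (by norm_num) (by norm_num)).const_mul _).const_add _
  have := ge_of_tendsto' hlim hfin
  simpa using this

section conc
open MeasureTheory

theorem hoeff1 {Z : Type*} [MeasurableSpace Z] (D : Measure Z) [IsProbabilityMeasure D]
    (g : Z → ℝ) (hg : Measurable g) (c : ℝ) (hc : 0 ≤ c) (hd : ∀ x y, g x - g y ≤ c) (l : ℝ) :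
    ∫ x, Real.exp (l * g x) ∂D ≤ Real.exp (l * ∫ x, g x ∂D) * Real.exp (c ^ 2 / 8 * l ^ 2) := by
  have hne : Nonempty Z := D.nonempty_of_neZero
  obtain ⟨x0⟩ := hne
  have hbb : BddBelow (Set.range g) := ⟨g x0 - c, by rintro _ ⟨y, rfl⟩; linarith [hd x0 y]⟩
  have hmem : ∀ x, g x ∈ Set.Icc (⨅ y, g y) ((⨅ y, g y) + c) := by
    intro x
    refine ⟨ciInf_le hbb x, ?_⟩
    have : Nonempty Z := ⟨x0⟩
    have : g x - c ≤ ⨅ y, g y := le_ciInf fun y => by linarith [hd x y]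
    linarith
  have h := (ProbabilityTheory.hasSubgaussianMGF_of_mem_Icc (μ := D) hg.aemeasurable
    (Filter.Eventually.of_forall hmem)).mgf_le l
  rw [ProbabilityTheory.mgf] at h
  have h2 : ∀ x, Real.exp (l * g x) = Real.exp (l * ∫ x, g x ∂D) *
      Real.exp (l * (g x - ∫ x, g x ∂D)) := by
    intro x; rw [← Real.exp_add]; congr 1; ring
  simp_rw [h2]
  rw [integral_const_mul]
  refine mul_le_mul_of_nonneg_left (h.trans (le_of_eq ?_)) (Real.exp_pos _).le
  congr 1
  have : ‖(⨅ y, g y) + c - ⨅ y, g y‖ = c := by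
    rw [add_sub_cancel_left, Real.norm_of_nonneg hc]
  push_cast
  rw [this]; ring

theorem integrable_bdd {Z : Type*} [MeasurableSpace Z] (D : Measure Z) [IsFiniteMeasure D]
    (g : Z → ℝ) (hg : Measurable g) (M : ℝ) (hM : ∀ x, |g x| ≤ M) : Integrable g D :=
  Integrable.of_bound hg.aestronglyMeasurable M (Filter.Eventually.of_forall hM)

theorem measurable_cons {Z : Type*} [MeasurableSpace Z] (n : ℕ) :
    Measurable (fun p : Z × (Fin n → Z) => (Fin.cons p.1 p.2 : Fin (n + 1) → Z)) := by
  rw [measurable_pi_iff]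
  intro i
  refine Fin.cases ?_ (fun j => ?_) i
  · simpa using measurable_fst
  · simp only [Fin.cons_succ]; exact (measurable_pi_apply j).comp (measurable_snd (α := Z) (β := Fin n → Z))

theorem integral_cons {Z : Type*} [MeasurableSpace Z] (D : Measure Z) [IsProbabilityMeasure D]
    (n : ℕ) (F : (Fin (n + 1) → Z) → ℝ) (hF : Measurable F) (M : ℝ) (hM : ∀ S, |F S| ≤ M) :
    ∫ S, F S ∂(Measure.pi fun _ : Fin (n + 1) => D) =
      ∫ x, ∫ S, F (Fin.cons x S) ∂(Measure.pi fun _ : Fin n => D) ∂D := by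
  have h := (measurePreserving_piFinSuccAbove (fun _ : Fin (n + 1) => D) 0).symm
  rw [← h.integral_comp']
  have hcons : ∀ p : Z × (Fin n → Z), (MeasurableEquiv.piFinSuccAbove (fun _ => Z) 0).symm p =
      (Fin.cons p.1 p.2 : Fin (n + 1) → Z) := by
    intro p
    simp [MeasurableEquiv.piFinSuccAbove_symm_apply, Fin.insertNthEquiv]
  simp_rw [hcons]
  rw [integral_prod]
  · exact integrable_bdd _ _ (hF.comp (measurable_cons n)) M (fun x => hM _)

theorem mcd_mgf {Z : Type*} [MeasurableSpace Z] (D : Measure Z) [IsProbabilityMeasure D]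
    (c : ℝ) (hc : 0 ≤ c) (l M : ℝ) (n : ℕ) (G : (Fin n → Z) → ℝ) (hm : Measurable G)
    (hM : ∀ S, |G S| ≤ M)
    (hd : ∀ i S z, |G (Function.update S i z) - G S| ≤ c) :
    ∫ S, Real.exp (l * G S) ∂(Measure.pi fun _ : Fin n => D) ≤
      Real.exp (l * ∫ S, G S ∂(Measure.pi fun _ : Fin n => D)) *
        Real.exp (n * (c ^ 2 / 8 * l ^ 2)) := by
  induction n with
  | zero =>
    have h0 : ∀ S, G S = G default := fun S => congrArg G (Subsingleton.elim _ _)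
    simp_rw [h0]
    simp
  | succ n ih =>
    have hmc := measurable_cons (Z := Z) n
    have hexpM : ∀ S, |Real.exp (l * G S)| ≤ Real.exp (|l| * M) := by
      intro S
      rw [abs_of_pos (Real.exp_pos _), Real.exp_le_exp]
      calc l * G S ≤ |l * G S| := le_abs_self _
        _ = |l| * |G S| := abs_mul _ _
        _ ≤ _ := by gcongr; exact hM S
    have hexpm : Measurable fun S => Real.exp (l * G S) := (hm.const_mul l).exp
    rw [integral_cons D n _ hexpm _ hexpM, integral_cons D n _ hm M hM]
    set g : Z → ℝ := fun x => ∫ S, G (Fin.cons x S) ∂(Measure.pi fun _ : Fin n => D) with hg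
    have hgm : Measurable g :=
      ((hm.comp hmc).stronglyMeasurable.integral_prod_right' (ν := Measure.pi fun _ : Fin n => D)).measurable
    have hsec : ∀ x, Measurable fun S : Fin n → Z => G (Fin.cons x S) := fun x =>
      hm.comp (hmc.comp (measurable_const.prodMk measurable_id))
    have hint : ∀ x, Integrable (fun S : Fin n → Z => G (Fin.cons x S))
        (Measure.pi fun _ : Fin n => D) := fun x =>
      integrable_bdd _ _ (hsec x) M fun S => hM _
    have hgd : ∀ x y, g x - g y ≤ c := by
      intro x y
      simp only [hg]
      rw [← integral_sub (hint x) (hint y)]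
      calc _ ≤ ∫ S, c ∂(Measure.pi fun _ : Fin n => D) := by
            apply integral_mono ((hint x).sub (hint y)) (integrable_const _)
            intro S
            have := hd 0 (Fin.cons y S) x
            rw [Fin.update_cons_zero] at this
            exact (abs_le.1 this).2
        _ = c := by simp
    have hin : ∀ x, ∫ S, Real.exp (l * G (Fin.cons x S)) ∂(Measure.pi fun _ : Fin n => D) ≤
        Real.exp (l * g x) * Real.exp (n * (c ^ 2 / 8 * l ^ 2)) := by
      intro x
      apply ih (fun S => G (Fin.cons x S)) (hsec x) (fun S => hM _)
      intro i S z
      have := hd i.succ (Fin.cons x S) z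
      rwa [← Fin.cons_update] at this
    have hgM : ∀ x, |g x| ≤ M := by
      intro x
      have := norm_integral_le_of_norm_le_const (μ := Measure.pi fun _ : Fin n => D)
        (f := fun S => G (Fin.cons x S)) (Filter.Eventually.of_forall fun S => hM _)
      simpa using this
    calc ∫ x, ∫ S, Real.exp (l * G (Fin.cons x S)) ∂(Measure.pi fun _ : Fin n => D) ∂D
        ≤ ∫ x, Real.exp (l * g x) * Real.exp (n * (c ^ 2 / 8 * l ^ 2)) ∂D := by
          apply integral_mono _ _ hin
          · refine integrable_bdd _ _ ?_ (Real.exp (|l| * M)) ?_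
            · exact ((hexpm.comp hmc).stronglyMeasurable.integral_prod_right'
                (ν := Measure.pi fun _ : Fin n => D)).measurable
            · intro x
              have := norm_integral_le_of_norm_le_const (μ := Measure.pi fun _ : Fin n => D)
                (f := fun S => Real.exp (l * G (Fin.cons x S)))
                (Filter.Eventually.of_forall fun S => hexpM _)
              simpa using this
          · refine (integrable_bdd _ _ (hgm.const_mul l).exp (Real.exp (|l| * M)) ?_).mul_const _
            intro x
            rw [abs_of_pos (Real.exp_pos _), Real.exp_le_exp]
            calc l * g x ≤ |l * g x| := le_abs_self _
              _ = |l| * |g x| := abs_mul _ _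
              _ ≤ _ := by gcongr; exact hgM x
      _ = (∫ x, Real.exp (l * g x) ∂D) * Real.exp (n * (c ^ 2 / 8 * l ^ 2)) := integral_mul_const _ _
      _ ≤ (Real.exp (l * ∫ x, g x ∂D) * Real.exp (c ^ 2 / 8 * l ^ 2)) *
          Real.exp (n * (c ^ 2 / 8 * l ^ 2)) := by
          gcongr
          exact hoeff1 D g hgm c hc hgd l
      _ = _ := by
          rw [mul_assoc, ← Real.exp_add]
          congr 2
          push_cast; ring

theorem mcd_tail {Z : Type*} [MeasurableSpace Z] (D : Measure Z) [IsProbabilityMeasure D]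
    (c : ℝ) (hc : 0 < c) (M : ℝ) (n : ℕ) (hn : 1 ≤ n) (G : (Fin n → Z) → ℝ) (hm : Measurable G)
    (hM : ∀ S, |G S| ≤ M)
    (hd : ∀ i S z, |G (Function.update S i z) - G S| ≤ c)
    (hE : ∫ S, G S ∂(Measure.pi fun _ : Fin n => D) ≤ 0) (t : ℝ) (ht : 0 ≤ t) :
    (Measure.pi fun _ : Fin n => D) {S | t < G S} ≤
      ENNReal.ofReal (Real.exp (-(2 * t ^ 2 / (n * c ^ 2)))) := by
  have hn0 : (0 : ℝ) < n := by exact_mod_cast hn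
  set μ := Measure.pi fun _ : Fin n => D
  set l := 4 * t / (n * c ^ 2) with hl
  have hl0 : 0 ≤ l := by positivity
  have hint : Integrable (fun S => Real.exp (l * G S)) μ := by
    refine integrable_bdd _ _ (hm.const_mul l).exp (Real.exp (l * M)) ?_
    intro S
    rw [abs_of_pos (Real.exp_pos _), Real.exp_le_exp]
    have := (abs_le.1 (hM S)).2
    gcongr
  have h1 := ProbabilityTheory.measure_ge_le_exp_mul_mgf (μ := μ) (X := G) t hl0 hint
  have h2 := mcd_mgf D c hc.le l M n G hm hM hd
  have h3 : μ.real {S | t ≤ G S} ≤ Real.exp (-(2 * t ^ 2 / (n * c ^ 2))) := by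
    refine h1.trans ?_
    rw [ProbabilityTheory.mgf]
    calc _ ≤ Real.exp (-l * t) * (Real.exp (l * ∫ S, G S ∂μ) * Real.exp (n * (c ^ 2 / 8 * l ^ 2))) := by
          gcongr
      _ ≤ Real.exp (-l * t) * (1 * Real.exp (n * (c ^ 2 / 8 * l ^ 2))) := by
          gcongr
          rw [Real.exp_le_one_iff]
          exact mul_nonpos_of_nonneg_of_nonpos hl0 hE
      _ = _ := by
          rw [one_mul, ← Real.exp_add, hl]
          congr 1
          field_simp
          ring
  calc μ {S | t < G S} ≤ μ {S | t ≤ G S} := measure_mono fun S (hS : t < G S) => hS.le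
    _ = ENNReal.ofReal (μ.real {S | t ≤ G S}) := by simp
    _ ≤ _ := ENNReal.ofReal_le_ofReal h3

end conc

section symm
set_option linter.unusedSectionVars false
set_option linter.unusedVariables false
open MeasureTheory

theorem abs_iSup_le' {ι : Type*} [Nonempty ι] (g : ι → ℝ) (M : ℝ) (h : ∀ q, |g q| ≤ M) :
    |⨆ q, g q| ≤ M := by
  have hb : BddAbove (Set.range g) := ⟨M, by rintro _ ⟨q, rfl⟩; exact (abs_le.1 (h q)).2⟩
  rw [abs_le]
  constructor
  · obtain ⟨q⟩ := ‹Nonempty ι›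
    exact (abs_le.1 (h q)).1.trans (le_ciSup hb q)
  · exact ciSup_le fun q => (abs_le.1 (h q)).2

theorem abs_iSup_sub_le {ι : Type*} [Nonempty ι] (g k : ι → ℝ) (M c : ℝ) (hg : ∀ q, |g q| ≤ M)
    (hk : ∀ q, |k q| ≤ M) (h : ∀ q, |g q - k q| ≤ c) : |(⨆ q, g q) - ⨆ q, k q| ≤ c := by
  have hb : BddAbove (Set.range g) := ⟨M, by rintro _ ⟨q, rfl⟩; exact (abs_le.1 (hg q)).2⟩
  have hb' : BddAbove (Set.range k) := ⟨M, by rintro _ ⟨q, rfl⟩; exact (abs_le.1 (hk q)).2⟩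
  have h1 : (⨆ q, g q) ≤ (⨆ q, k q) + c := ciSup_le fun q => by
    have := le_ciSup hb' q
    linarith [(abs_le.1 (h q)).2]
  have h2 : (⨆ q, k q) ≤ (⨆ q, g q) + c := ciSup_le fun q => by
    have := le_ciSup hb q
    linarith [(abs_le.1 (h q)).1]
  rw [abs_le]; constructor <;> linarith

theorem abs_rdot_le {n : ℕ} (ε : Fin n → Bool) (v : Fin n → ℝ) (hv : ∀ i, |v i| ≤ 1) :
    |rdot ε v| ≤ n := by
  unfold rdot
  refine (Finset.abs_sum_le_sum_abs _ _).trans ?_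
  calc _ ≤ ∑ i : Fin n, (1 : ℝ) := Finset.sum_le_sum fun i _ => by
        rw [abs_mul, sgn'_abs, one_mul]; exact hv i
    _ = n := by simp

theorem ravg_not {n : ℕ} (g : (Fin n → Bool) → ℝ) :
    ravg (fun ε => g (fun i => !(ε i))) = ravg g := by
  unfold ravg
  congr 1
  have hinv : Function.Involutive (fun (ε : Fin n → Bool) (i : Fin n) => !(ε i)) := by
    intro ε; ext i; simp
  exact Function.Bijective.sum_comp hinv.bijective g

variable {Z : Type*} [MeasurableSpace Z] (D : Measure Z) [IsProbabilityMeasure D]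
  {ι : Type*} [Countable ι] [Nonempty ι] (f : ι → Z → ℝ) (hf : ∀ q, Measurable (f q))
  (h0 : ∀ q z, 0 ≤ f q z) (h1 : ∀ q z, f q z ≤ 1) (n : ℕ)

noncomputable def radS (S : Fin n → Z) : ℝ := ravg (fun ε => ⨆ q, rdot ε (fun i => f q (S i)))

noncomputable def psiS (S : Fin n → Z) : ℝ :=
  ⨆ q, (n * (∫ z, f q z ∂D) - ∑ i, f q (S i))

theorem ravg_abs_le {n : ℕ} (g : (Fin n → Bool) → ℝ) (M : ℝ) (h : ∀ ε, |g ε| ≤ M) :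
    |ravg g| ≤ M := by
  rw [abs_le]
  constructor
  · rw [← ravg_const (n := n) (-M)]; exact ravg_mono fun ε => (abs_le.1 (h ε)).1
  · rw [← ravg_const (n := n) M]; exact ravg_mono fun ε => (abs_le.1 (h ε)).2

include h0 h1 in
theorem f_abs (q : ι) (z : Z) : |f q z| ≤ 1 := abs_le.2 ⟨by linarith [h0 q z], h1 q z⟩

include h0 h1 in
theorem f_abs_sub (q : ι) (z z' : Z) : |f q z - f q z'| ≤ 1 :=
  abs_le.2 ⟨by linarith [h0 q z, h1 q z'], by linarith [h1 q z, h0 q z']⟩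

include h0 h1 in
theorem radS_abs (S : Fin n → Z) : |radS f n S| ≤ n :=
  ravg_abs_le _ _ fun ε => abs_iSup_le' _ _ fun q => abs_rdot_le _ _ fun i => f_abs f h0 h1 q _

include h0 h1 in
theorem psi_in_abs (q : ι) (S : Fin n → Z) : |n * (∫ z, f q z ∂D) - ∑ i, f q (S i)| ≤ n := by
  have hi0 : 0 ≤ ∫ z, f q z ∂D := integral_nonneg (h0 q)
  have hi1 : ∫ z, f q z ∂D ≤ 1 := by
    have := norm_integral_le_of_norm_le_const (μ := D) (f := f q)
      (Filter.Eventually.of_forall fun z => f_abs f h0 h1 q z)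
    have := (abs_le.1 this).2
    simpa using this
  have hs0 : 0 ≤ ∑ i, f q (S i) := Finset.sum_nonneg fun i _ => h0 _ _
  have hs1 : ∑ i, f q (S i) ≤ n := by
    calc _ ≤ ∑ i : Fin n, (1 : ℝ) := Finset.sum_le_sum fun i _ => h1 _ _
      _ = n := by simp
  have hn : (0 : ℝ) ≤ n := by positivity
  rw [abs_le]; constructor <;> nlinarith

include hf in
theorem meas_sup_rdot (ε : Fin n → Bool) :
    Measurable fun S : Fin n → Z => ⨆ q, rdot ε (fun i => f q (S i)) := by
  apply Measurable.iSup
  intro q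
  unfold rdot
  exact Finset.measurable_sum _ fun i _ => ((hf q).comp (measurable_pi_apply i)).const_mul _

include hf in
theorem meas_radS : Measurable (radS f n : (Fin n → Z) → ℝ) := by
  unfold radS ravg
  exact (Finset.measurable_sum _ fun ε _ => meas_sup_rdot f hf n ε).div_const _

include hf in
theorem meas_psiS : Measurable (psiS D f n : (Fin n → Z) → ℝ) := by
  unfold psiS
  apply Measurable.iSup
  intro q
  exact measurable_const.sub (Finset.measurable_sum _ fun i _ => (hf q).comp (measurable_pi_apply i))

theorem sum_update_sub (v w : Fin n → ℝ) (i : Fin n) (h : ∀ j, j ≠ i → v j = w j)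
    (hi : |v i - w i| ≤ 1) (s : Fin n → ℝ) (hs : |s i| = 1) :
    |∑ j, s j * v j - ∑ j, s j * w j| ≤ 1 := by
  rw [← Finset.sum_sub_distrib, Finset.sum_eq_single i]
  · rw [← mul_sub, abs_mul, hs, one_mul]; exact hi
  · intro j _ hj; rw [h j hj, sub_self]
  · simp

include h0 h1 in
theorem radS_diff (i : Fin n) (S : Fin n → Z) (z : Z) :
    |radS f n (Function.update S i z) - radS f n S| ≤ 1 := by
  have : radS f n (Function.update S i z) - radS f n S =
      ravg (fun ε => (⨆ q, rdot ε (fun j => f q (Function.update S i z j))) -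
        ⨆ q, rdot ε (fun j => f q (S j))) := by
    unfold radS ravg; rw [Finset.sum_sub_distrib, sub_div]
  rw [this]
  apply ravg_abs_le
  intro ε
  refine abs_iSup_sub_le _ _ n _ (fun q => abs_rdot_le _ _ fun i => f_abs f h0 h1 q _)
    (fun q => abs_rdot_le _ _ fun i => f_abs f h0 h1 q _) fun q => ?_
  unfold rdot
  apply sum_update_sub n _ _ i
  · intro j hj; rw [Function.update_of_ne hj]
  · exact f_abs_sub f h0 h1 q _ _
  · exact sgn'_abs _

include h0 h1 in
theorem psiS_diff (i : Fin n) (S : Fin n → Z) (z : Z) :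
    |psiS D f n (Function.update S i z) - psiS D f n S| ≤ 1 := by
  unfold psiS
  refine abs_iSup_sub_le _ _ n _ (fun q => psi_in_abs D f h0 h1 n q _)
    (fun q => psi_in_abs D f h0 h1 n q _) fun q => ?_
  rw [sub_sub_sub_cancel_left]
  have := sum_update_sub n (fun j => f q (S j)) (fun j => f q (Function.update S i z j)) i
    (fun j hj => by rw [Function.update_of_ne hj]) (f_abs_sub f h0 h1 q _ _) (fun _ => 1) (by simp)
  simpa using this

noncomputable def wS (ε : Fin n → Bool) (p : (Fin n → Z) × (Fin n → Z)) : ℝ :=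
  ⨆ q, rdot ε (fun i => f q (p.1 i) - f q (p.2 i))

include hf in
theorem meas_wS (ε : Fin n → Bool) : Measurable (wS f n ε) := by
  unfold wS
  apply Measurable.iSup
  intro q
  unfold rdot
  refine Finset.measurable_sum _ fun i _ => Measurable.const_mul (Measurable.sub ?_ ?_) _
  · exact (hf q).comp ((measurable_pi_apply i).comp measurable_fst)
  · exact (hf q).comp ((measurable_pi_apply i).comp measurable_snd)

include h0 h1 in
theorem wS_abs (ε : Fin n → Bool) (p : (Fin n → Z) × (Fin n → Z)) : |wS f n ε p| ≤ n :=
  abs_iSup_le' _ _ fun q => abs_rdot_le _ _ fun i => f_abs_sub f h0 h1 q _ _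

include hf in
theorem wS_swap (ε : Fin n → Bool) :
    ∫ p, wS f n ε p ∂((Measure.pi fun _ : Fin n => D).prod (Measure.pi fun _ : Fin n => D)) =
    ∫ p, wS f n (fun _ => true) p
      ∂((Measure.pi fun _ : Fin n => D).prod (Measure.pi fun _ : Fin n => D)) := by
  have hA := measurePreserving_arrowProdEquivProdArrow Z Z (Fin n) (fun _ => D) (fun _ => D)
  rw [← hA.integral_comp', ← hA.integral_comp']
  set ν := Measure.pi fun _ : Fin n => D.prod D
  have hφ : MeasurePreserving (fun (a : Fin n → Z × Z) i => (cond (ε i) id Prod.swap) (a i)) ν ν := by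
    apply measurePreserving_pi
    intro i
    cases ε i
    · exact Measure.measurePreserving_swap
    · exact MeasurePreserving.id _
  have hmeas : Measurable fun a : Fin n → Z × Z => wS f n (fun _ => true)
      (MeasurableEquiv.arrowProdEquivProdArrow Z Z (Fin n) a) :=
    (meas_wS f hf n _).comp (MeasurableEquiv.measurable _)
  conv_rhs => rw [← hφ.map_eq]
  rw [integral_map hφ.measurable.aemeasurable hmeas.aestronglyMeasurable]
  congr 1
  ext a
  unfold wS rdot
  congr 1
  ext q
  apply Finset.sum_congr rfl
  intro i _
  simp only [MeasurableEquiv.arrowProdEquivProdArrow, MeasurableEquiv.coe_mk,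
    Equiv.arrowProdEquivProdArrow, Equiv.coe_fn_mk]
  cases ε i <;> simp [sgn']

include hf h0 h1 in
theorem symm_bound :
    ∫ S, psiS D f n S ∂(Measure.pi fun _ : Fin n => D) ≤
      2 * ∫ S, radS f n S ∂(Measure.pi fun _ : Fin n => D) := by
  set μ := Measure.pi fun _ : Fin n => D with hμ
  set r : (Fin n → Bool) → ℝ := fun ε => ∫ S, (⨆ q, rdot ε (fun i => f q (S i))) ∂μ with hr
  have hrint : ∀ ε : Fin n → Bool, Integrable (fun S => ⨆ q, rdot ε (fun i => f q (S i))) μ :=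
    fun ε => integrable_bdd _ _ (meas_sup_rdot f hf n ε) n fun S =>
      abs_iSup_le' _ _ fun q => abs_rdot_le _ _ fun i => f_abs f h0 h1 q _
  have hwint : ∀ ε, Integrable (wS f n ε) (μ.prod μ) := fun ε =>
    integrable_bdd _ _ (meas_wS f hf n ε) n (wS_abs f h0 h1 n ε)
  have hrad : ∫ S, radS f n S ∂μ = ravg r := by
    unfold radS ravg
    rw [integral_div, integral_finsetSum _ fun ε _ => hrint ε]
  have hW : ∫ S, psiS D f n S ∂μ ≤ ∫ p, wS f n (fun _ => true) p ∂(μ.prod μ) := by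
    have hp : Integrable (psiS D f n) μ := integrable_bdd _ _ (meas_psiS D f hf n) n fun S =>
      abs_iSup_le' _ _ fun q => psi_in_abs D f h0 h1 n q S
    rw [integral_prod_symm _ (hwint _)]
    refine integral_mono hp (hwint _).integral_prod_right ?_
    intro S
    unfold psiS
    apply ciSup_le
    intro q
    have hsec : Integrable (fun S' => wS f n (fun _ => true) (S', S)) μ :=
      integrable_bdd _ _ ((meas_wS f hf n _).comp (measurable_id.prodMk measurable_const)) n
        fun S' => wS_abs f h0 h1 n _ _
    have hfi : ∀ i, Integrable (fun S' : Fin n → Z => f q (S' i)) μ := fun i =>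
      integrable_bdd _ _ ((hf q).comp (measurable_pi_apply i)) 1 fun S' => f_abs f h0 h1 q _
    have hev : ∀ i : Fin n, ∫ S', f q (S' i) ∂μ = ∫ z, f q z ∂D := by
      intro i
      have hmp := measurePreserving_eval (fun _ : Fin n => D) i
      rw [← hmp.map_eq, integral_map hmp.measurable.aemeasurable (hf q).aestronglyMeasurable]
    have : (n * (∫ z, f q z ∂D) - ∑ i, f q (S i)) =
        ∫ S', (∑ i, f q (S' i) - ∑ i, f q (S i)) ∂μ := by
      rw [integral_sub (integrable_finsetSum _ fun i _ => hfi i) (integrable_const _),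
        integral_finsetSum _ fun i _ => hfi i]
      simp only [hev]
      simp
    rw [this]
    refine integral_mono ((integrable_finsetSum _ fun i _ => hfi i).sub (integrable_const _))
      hsec ?_
    intro S'
    have hb : BddAbove (Set.range fun q => rdot (fun _ : Fin n => true)
        (fun i => f q (S' i) - f q (S i))) :=
      ⟨n, by rintro _ ⟨q, rfl⟩; exact (abs_le.1 (abs_rdot_le _ _ fun i =>
        f_abs_sub f h0 h1 q _ _)).2⟩
    have := le_ciSup hb q
    refine le_trans (le_of_eq ?_) this
    simp [rdot, sgn']
  have hbound : ∀ ε : Fin n → Bool, ∫ p, wS f n (fun _ => true) p ∂(μ.prod μ) ≤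
      r ε + r (fun i => !(ε i)) := by
    intro ε
    rw [← wS_swap D f hf n ε]
    have e1 : r ε = ∫ p, (⨆ q, rdot ε (fun i => f q (p.1 i))) ∂(μ.prod μ) := by
      rw [integral_fun_fst (μ := μ) (ν := μ) (f := fun S => ⨆ q, rdot ε (fun i => f q (S i)))]; simp [hr]
    have e2 : r (fun i => !(ε i)) =
        ∫ p, (⨆ q, rdot (fun i => !(ε i)) (fun i => f q (p.2 i))) ∂(μ.prod μ) := by
      rw [integral_fun_snd (μ := μ) (ν := μ)
        (f := fun S => ⨆ q, rdot (fun i => !(ε i)) (fun i => f q (S i)))]; simp [hr]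
    have i1 := (hrint ε).comp_fst (ν := μ)
    have i2 := (hrint (fun i => !(ε i))).comp_snd (μ := μ)
    rw [e1, e2, ← integral_add i1 i2]
    refine integral_mono (hwint ε) (i1.add i2) ?_
    intro p
    unfold wS
    apply ciSup_le
    intro q
    have hb : ∀ (ε : Fin n → Bool) (S : Fin n → Z),
        BddAbove (Set.range fun q => rdot ε (fun i => f q (S i))) := fun ε S =>
      ⟨n, by rintro _ ⟨q, rfl⟩; exact (abs_le.1 (abs_rdot_le _ _ fun i => f_abs f h0 h1 q _)).2⟩
    have a1 := le_ciSup (hb ε p.1) q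
    have a2 := le_ciSup (hb (fun i => !(ε i)) p.2) q
    refine le_trans (le_of_eq ?_) (add_le_add a1 a2)
    simp only [rdot]
    rw [← Finset.sum_add_distrib]
    apply Finset.sum_congr rfl
    intro i _
    cases ε i <;> simp [sgn'] <;> ring
  rw [hrad]
  refine hW.trans ?_
  rw [← ravg_const (n := n) (∫ p, wS f n (fun _ => true) p ∂(μ.prod μ))]
  refine (ravg_mono hbound).trans (le_of_eq ?_)
  rw [ravg_add, ravg_not]; ring

include hf h0 h1 in
theorem gen_abstract (hn : 1 ≤ n) (δ : ℝ) (hδ0 : 0 < δ) (hδ1 : δ < 1) :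
    (Measure.pi fun _ : Fin n => D) {S | ∃ q, (1 / n : ℝ) * (∑ i, f q (S i)) +
      2 * radS f n S / n + 3 * Real.sqrt (Real.log (1 / δ) / (2 * n)) < ∫ z, f q z ∂D} ≤
      ENNReal.ofReal δ := by
  have hn0 : (0 : ℝ) < n := by exact_mod_cast hn
  have hlog : 0 < Real.log (1 / δ) := Real.log_pos (by rw [lt_div_iff₀ hδ0]; linarith)
  set t := n * (3 * Real.sqrt (Real.log (1 / δ) / (2 * n))) with ht
  have hpi : ∀ S, |psiS D f n S| ≤ n := fun S =>
    abs_iSup_le' _ _ fun q => psi_in_abs D f h0 h1 n q S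
  have hri := radS_abs f h0 h1 n
  have hE : ∫ S, (psiS D f n S - 2 * radS f n S) ∂(Measure.pi fun _ : Fin n => D) ≤ 0 := by
    rw [integral_sub, integral_const_mul]
    · linarith [symm_bound D f hf h0 h1 n]
    · exact integrable_bdd _ _ (meas_psiS D f hf n) n hpi
    · exact (integrable_bdd _ _ (meas_radS f hf n) n hri).const_mul _
  have := mcd_tail D 3 (by norm_num) (3 * n) n hn (fun S => psiS D f n S - 2 * radS f n S)
    ((meas_psiS D f hf n).sub ((meas_radS f hf n).const_mul 2))
    (fun S => by
      have a := abs_le.1 (hpi S)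
      have b := abs_le.1 (hri S)
      rw [abs_le]; constructor <;> linarith)
    (fun i S z => by
      have a := abs_le.1 (psiS_diff D f h0 h1 n i S z)
      have b := abs_le.1 (radS_diff f h0 h1 n i S z)
      rw [abs_le]; constructor <;> linarith) hE t (by positivity)
  refine (measure_mono ?_).trans (this.trans (ENNReal.ofReal_le_ofReal (le_of_eq ?_)))
  · rintro S ⟨q, hq⟩
    have hb : BddAbove (Set.range fun q => (n * (∫ z, f q z ∂D) - ∑ i, f q (S i))) :=
      ⟨n, by rintro _ ⟨q, rfl⟩; exact (abs_le.1 (psi_in_abs D f h0 h1 n q S)).2⟩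
    have h2 := le_ciSup hb q
    change t < psiS D f n S - 2 * radS f n S
    unfold psiS
    have h3 := mul_lt_mul_of_pos_left hq hn0
    have h4 : (n : ℝ) * ((1 / n : ℝ) * (∑ i, f q (S i)) +
      2 * radS f n S / n + 3 * Real.sqrt (Real.log (1 / δ) / (2 * n))) =
        (∑ i, f q (S i)) + 2 * radS f n S + t := by
      rw [ht]; field_simp
    rw [h4] at h3
    linarith
  · have h5 : 2 * t ^ 2 / (n * 3 ^ 2) = Real.log (1 / δ) := by
      rw [ht, mul_pow, mul_pow, Real.sq_sqrt (by positivity)]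
      field_simp
    rw [h5, one_div, Real.log_inv, neg_neg, Real.exp_log hδ0]

end symm

noncomputable def en {n : ℕ} (v : Fin n → ℝ) : ℝ := Real.sqrt (∑ j, v j ^ 2)

theorem en_eq {n : ℕ} (v : Fin n → ℝ) : en v = ‖(WithLp.toLp 2 v : EuclideanSpace ℝ (Fin n))‖ := by
  rw [EuclideanSpace.norm_eq]; simp [en]

theorem en_nonneg {n : ℕ} (v : Fin n → ℝ) : 0 ≤ en v := Real.sqrt_nonneg _

theorem en_sq {n : ℕ} (v : Fin n → ℝ) : en v ^ 2 = ∑ j, v j ^ 2 :=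
  Real.sq_sqrt (Finset.sum_nonneg fun _ _ => sq_nonneg _)

theorem en_add {n : ℕ} (u v : Fin n → ℝ) : en (u + v) ≤ en u + en v := by
  simp only [en_eq, WithLp.toLp_add]; exact norm_add_le _ _

theorem abs_le_en {n : ℕ} (v : Fin n → ℝ) (j : Fin n) : |v j| ≤ en v := by
  rw [← Real.sqrt_sq_eq_abs]
  exact Real.sqrt_le_sqrt (Finset.single_le_sum (f := fun j => v j ^ 2)
    (fun _ _ => sq_nonneg _) (Finset.mem_univ j))

theorem en_mulVec {p q : ℕ} (M : Matrix (Fin p) (Fin q) ℝ) (v : Fin q → ℝ) :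
    en (M.mulVec v) ≤ specNorm M * en v := by
  have := (LinearMap.toContinuousLinearMap (Matrix.toEuclideanLin M)).le_opNorm (WithLp.toLp 2 v)
  rw [en_eq, en_eq, specNorm]
  simpa using this

theorem frobNorm_sq {α β : Type*} [Fintype α] [Fintype β] (M : Matrix α β ℝ) :
    frobNorm M ^ 2 = ∑ i, ∑ j, (M i j) ^ 2 :=
  Real.sq_sqrt (Finset.sum_nonneg fun _ _ => Finset.sum_nonneg fun _ _ => sq_nonneg _)

theorem frobNorm_nonneg {α β : Type*} [Fintype α] [Fintype β] (M : Matrix α β ℝ) :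
    0 ≤ frobNorm M := Real.sqrt_nonneg _

theorem en_mulVec_frob {p q : ℕ} (M : Matrix (Fin p) (Fin q) ℝ) (v : Fin q → ℝ) :
    en (M.mulVec v) ≤ frobNorm M * en v := by
  apply le_of_sq_le_sq _ (mul_nonneg (frobNorm_nonneg _) (en_nonneg _))
  rw [mul_pow, frobNorm_sq, en_sq, en_sq, Finset.sum_mul]
  apply Finset.sum_le_sum
  intro i _
  exact Finset.sum_mul_sq_le_sq_mul_sq Finset.univ (fun j => M i j) v

theorem gamma_mulVec {c r d m : ℕ} (S : Fin m → Fin r → Fin d) (W : Matrix (Fin c) (Fin r) ℝ)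
    (v : Fin d → ℝ) (ik : Fin c × Fin m) :
    (gamma S W).mulVec v ik = ∑ p, W ik.1 p * v (S ik.2 p) := by
  simp only [Matrix.mulVec, dotProduct, gamma, Finset.sum_mul]
  rw [Finset.sum_comm]
  apply Finset.sum_congr rfl
  intro p _
  simp

theorem en_gamma {c r d m d' : ℕ} (S : Fin m → Fin r → Fin d) (hS : ∀ k, Function.Injective (S k))
    (W : Matrix (Fin c) (Fin r) ℝ) (e : Fin c × Fin m ≃ Fin d') (v : Fin d → ℝ) :
    en ((Matrix.reindex e (Equiv.refl (Fin d)) (gamma S W)).mulVec v) ≤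
      Real.sqrt m * frobNorm W * en v := by
  apply le_of_sq_le_sq _ (mul_nonneg (mul_nonneg (Real.sqrt_nonneg _) (frobNorm_nonneg _))
    (en_nonneg _))
  have h1 : ∀ j, (Matrix.reindex e (Equiv.refl (Fin d)) (gamma S W)).mulVec v j =
      (gamma S W).mulVec v (e.symm j) := by
    intro j; simp [Matrix.mulVec, dotProduct]
  rw [en_sq, mul_pow, mul_pow, Real.sq_sqrt (by positivity), frobNorm_sq, en_sq]
  simp only [h1]
  rw [Equiv.sum_comp e.symm (fun ik => (gamma S W).mulVec v ik ^ 2), Fintype.sum_prod_type]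
  simp only [gamma_mulVec]
  have h2 : ∀ (i : Fin c) (t : Fin m), (∑ p, W i p * v (S t p)) ^ 2 ≤
      (∑ p, W i p ^ 2) * ∑ j, v j ^ 2 := by
    intro i t
    refine (Finset.sum_mul_sq_le_sq_mul_sq Finset.univ (fun p => W i p) (fun p => v (S t p))).trans ?_
    apply mul_le_mul_of_nonneg_left _ (Finset.sum_nonneg fun _ _ => sq_nonneg _)
    rw [← Finset.sum_image (s := Finset.univ) (g := S t) (f := fun j => v j ^ 2)
      (fun a _ b _ hab => hS t hab)]
    exact Finset.sum_le_sum_of_subset_of_nonneg (Finset.subset_univ _) fun _ _ _ => sq_nonneg _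
  calc _ ≤ ∑ i : Fin c, ∑ t : Fin m, (∑ p, W i p ^ 2) * ∑ j, v j ^ 2 :=
        Finset.sum_le_sum fun i _ => Finset.sum_le_sum fun t _ => h2 i t
    _ = _ := by
        simp only [Finset.sum_const, Finset.card_univ, Fintype.card_fin, nsmul_eq_mul]
        rw [← Finset.mul_sum, ← Finset.sum_mul]; ring

theorem gamma_sub {c r d m : ℕ} (S : Fin m → Fin r → Fin d) (W W' : Matrix (Fin c) (Fin r) ℝ) :
    gamma S (W - W') = gamma S W - gamma S W' := by
  ext ik j
  simp only [gamma, Matrix.sub_apply]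
  rw [← Finset.sum_sub_distrib]
  apply Finset.sum_congr rfl
  intro p _
  split_ifs <;> simp

theorem param_net (c r : ℕ) (P : Matrix (Fin c) (Fin r) ℝ → Prop) (a e κ : ℝ) (ha : 0 ≤ a)
    (he : 0 < e) (hκ : 0 ≤ κ) (hP : ∀ W, P W → frobNorm W ≤ a) :
    ∃ N : Finset (Matrix (Fin c) (Fin r) ℝ), (∀ W ∈ N, P W) ∧
      (N.card : ℝ) ≤ (1 + 2 * (a * κ) / e) ^ (c * r) ∧
      ∀ W, P W → ∃ W' ∈ N, κ * frobNorm (W - W') ≤ e := by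
  classical
  let E := EuclideanSpace ℝ (Fin c × Fin r)
  let φ : E → Matrix (Fin c) (Fin r) ℝ := fun x i j => x (i, j)
  have hφ : ∀ x y : E, frobNorm (φ x - φ y) = ‖x - y‖ := by
    intro x y
    rw [EuclideanSpace.norm_eq, frobNorm, Fintype.sum_prod_type]
    simp [φ]
    rfl
  have hφ0 : ∀ x : E, frobNorm (φ x) = ‖x‖ := by
    intro x
    rw [EuclideanSpace.norm_eq, frobNorm, Fintype.sum_prod_type]
    simp [φ]
  have hsurj : ∀ W, ∃ x, φ x = W := fun W => ⟨WithLp.toLp 2 (fun p => W p.1 p.2), rfl⟩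
  obtain ⟨t, ht, hc, hcov⟩ := aux_exists_net (E := E) a e κ ha he hκ {x | P (φ x)}
    (fun x hx => by rw [← hφ0]; exact hP _ hx)
  refine ⟨t.image φ, ?_, ?_, ?_⟩
  · intro W hW
    obtain ⟨x, hx, rfl⟩ := Finset.mem_image.1 hW
    exact ht x hx
  · have : Module.finrank ℝ E = c * r := by simp [E]
    rw [this] at hc
    refine le_trans ?_ hc
    exact_mod_cast Finset.card_image_le
  · intro W hW
    obtain ⟨x, rfl⟩ := hsurj W
    obtain ⟨y, hy, h⟩ := hcov x hW
    exact ⟨φ y, Finset.mem_image_of_mem _ hy, by rw [hφ]; exact h⟩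

theorem rampFn_eq (η r : ℝ) (hη : 0 < η) : rampFn η r = max 0 (min 1 (1 + r / η)) := by
  unfold rampFn
  split_ifs with h1 h2
  · have : 1 + r / η < 0 := by
      have : r / η < -1 := by rw [div_lt_iff₀ hη]; linarith
      linarith
    rw [min_eq_right (by linarith), max_eq_left this.le]
  · have h3 : r / η ≤ 0 := div_nonpos_of_nonpos_of_nonneg h2 hη.le
    have h4 : -1 ≤ r / η := by rw [le_div_iff₀ hη]; linarith
    rw [min_eq_right (by linarith), max_eq_right (by linarith)]
  · have h3 : 0 ≤ r / η := div_nonneg (by linarith) hη.le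
    rw [min_eq_left (by linarith), max_eq_right (by norm_num)]

theorem rampFn_lip (η r r' : ℝ) (hη : 0 < η) : |rampFn η r - rampFn η r'| ≤ |r - r'| / η := by
  rw [rampFn_eq _ _ hη, rampFn_eq _ _ hη]
  have h1 := abs_max_sub_max_le_abs (min 1 (1 + r / η)) (min 1 (1 + r' / η)) 0
  rw [max_comm 0, max_comm 0]
  refine h1.trans ?_
  have h2 := abs_min_sub_min_le_max 1 (1 + r / η) 1 (1 + r' / η)
  refine h2.trans ?_
  have h3 : 1 + r / η - (1 + r' / η) = (r - r') / η := by ring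
  rw [h3, abs_div, abs_of_pos hη]
  simp
  positivity

theorem sSup_lip {k : ℕ} (v w : Fin k → ℝ) (A : Set (Fin k)) (c : ℝ) (hc : 0 ≤ c)
    (h : ∀ j, |v j - w j| ≤ c) : |sSup (v '' A) - sSup (w '' A)| ≤ c := by
  rcases A.eq_empty_or_nonempty with rfl | hA
  · simpa using hc
  have hb : ∀ v : Fin k → ℝ, BddAbove (v '' A) := fun v => (Set.toFinite _).bddAbove
  have h1 : ∀ v w : Fin k → ℝ, (∀ j, |v j - w j| ≤ c) → sSup (v '' A) ≤ sSup (w '' A) + c := by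
    intro v w h
    apply csSup_le (hA.image v)
    rintro _ ⟨j, hj, rfl⟩
    have := le_csSup (hb w) (Set.mem_image_of_mem w hj)
    linarith [(abs_le.1 (h j)).2]
  rw [abs_le]
  constructor
  · linarith [h1 w v fun j => by rw [abs_sub_comm]; exact h j]
  · linarith [h1 v w h]

theorem rampLoss_lip {k : ℕ} (η : ℝ) (hη : 0 < η) (v w : Fin k → ℝ) (y : Fin k) :
    |rampLoss η v y - rampLoss η w y| ≤ 2 / η * en (v - w) := by
  refine (rampFn_lip _ _ _ hη).trans ?_
  rw [div_mul_eq_mul_div]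
  have h : ∀ j, |v j - w j| ≤ en (v - w) := fun j => abs_le_en (v - w) j
  have h1 := sSup_lip v w {j | j ≠ y} _ (en_nonneg _) h
  have h2 := h y
  gcongr
  rw [abs_le] at *
  constructor <;> linarith

theorem rampLoss_nonneg {k : ℕ} (η : ℝ) (hη : 0 < η) (v : Fin k → ℝ) (y : Fin k) :
    0 ≤ rampLoss η v y := by
  unfold rampLoss; rw [rampFn_eq _ _ hη]; exact le_max_left _ _

theorem rampLoss_le_one {k : ℕ} (η : ℝ) (hη : 0 < η) (v : Fin k → ℝ) (y : Fin k) :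
    rampLoss η v y ≤ 1 := by
  unfold rampLoss; rw [rampFn_eq _ _ hη]; exact max_le (by norm_num) (min_le_left _ _)

theorem rampLoss_eq_one {k : ℕ} (η : ℝ) (hη : 0 < η) (v : Fin k → ℝ) (y : Fin k)
    (h : v y ≤ sSup (v '' {j | j ≠ y})) : rampLoss η v y = 1 := by
  unfold rampLoss; rw [rampFn_eq _ _ hη]
  have : 0 ≤ -(v y - sSup (v '' {j | j ≠ y})) / η := div_nonneg (by linarith) hη.le
  rw [min_eq_left (by linarith)]; simp

theorem rampLoss_cont {k : ℕ} (η : ℝ) (hη : 0 < η) (y : Fin k) :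
    Continuous fun v : Fin k → ℝ => rampLoss η v y := by
  rw [continuous_iff_continuousAt]
  intro w
  rw [ContinuousAt, tendsto_iff_dist_tendsto_zero]
  have hlim : Filter.Tendsto (fun v : Fin k → ℝ => 2 / η * en (v - w)) (nhds w) (nhds 0) := by
    have hc : Continuous (fun v : Fin k → ℝ => 2 / η * en (v - w)) := by
      unfold en
      simp only [Pi.sub_apply]
      fun_prop
    have := hc.tendsto w
    simpa [en] using this
  exact squeeze_zero (fun _ => dist_nonneg) (fun v => by
    rw [Real.dist_eq]; exact rampLoss_lip η hη v w y) hlim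

section net
variable (L : ℕ) (d : ℕ → ℕ) (σ : ∀ i : ℕ, (Fin (d (i+1)) → ℝ) → (Fin (d (i+1)) → ℝ))
    (ρ s : ℕ → ℝ)
    (hρ : ∀ i < L, 0 ≤ ρ i) (hs : ∀ i < L, 0 < s i)
    (hσ : ∀ i < L, ∀ u v : Fin (d (i+1)) → ℝ,
      Real.sqrt (∑ j, (σ i u j - σ i v j) ^ 2) ≤ ρ i * Real.sqrt (∑ j, (u j - v j) ^ 2))
    (hσ0 : ∀ i < L, σ i 0 = 0)

include hσ in
theorem sig_lip (i : ℕ) (hi : i < L) (u v) : en (σ i u - σ i v) ≤ ρ i * en (u - v) := hσ i hi u v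

include hσ in
theorem sig_cont (i : ℕ) (hi : i < L) : Continuous (σ i) := by
  rw [continuous_pi_iff]
  intro j
  rw [continuous_iff_continuousAt]
  intro w
  rw [ContinuousAt, tendsto_iff_dist_tendsto_zero]
  have hlim : Filter.Tendsto (fun v => ρ i * en (v - w)) (nhds w) (nhds 0) := by
    have hc : Continuous (fun v => ρ i * en (v - w)) := by
      unfold en
      simp only [Pi.sub_apply]
      fun_prop
    have := hc.tendsto w
    simpa [en] using this
  exact squeeze_zero (fun _ => dist_nonneg) (fun v => by
    rw [Real.dist_eq]
    exact (abs_le_en (σ i v - σ i w) j).trans (sig_lip L d σ ρ hσ i hi v w)) hlim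

include hσ in
theorem net_cont {X : Type*} [TopologicalSpace X]
    (C : X → ∀ i : ℕ, Matrix (Fin (d (i+1))) (Fin (d i)) ℝ) (x : X → Fin (d 0) → ℝ)
    (hC : Continuous C) (hx : Continuous x) (l : ℕ) (hl : l ≤ L) :
    Continuous fun t => netVec d (C t) σ (x t) l := by
  induction l with
  | zero => exact hx
  | succ l ih =>
    have h1 := ih (by omega)
    have h2 : Continuous fun t => (C t l).mulVec (netVec d (C t) σ (x t) l) :=
      ((continuous_apply l).comp hC).matrix_mulVec h1
    exact (sig_cont L d σ ρ hσ l (by omega)).comp h2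

include hρ hs hσ hσ0 in
theorem net_bound (C : ∀ i : ℕ, Matrix (Fin (d (i+1))) (Fin (d i)) ℝ)
    (hC : ∀ i < L, specNorm (C i) ≤ s i) (x : Fin (d 0) → ℝ) (l : ℕ) (hl : l ≤ L) :
    en (netVec d C σ x l) ≤ (∏ i ∈ Finset.range l, ρ i * s i) * en x := by
  induction l with
  | zero => simp [netVec]
  | succ l ih =>
    have hl' : l < L := by omega
    have h1 := ih (by omega)
    have h2 := sig_lip L d σ ρ hσ l hl' ((C l).mulVec (netVec d C σ x l)) 0
    rw [hσ0 l hl', sub_zero, sub_zero] at h2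
    have h3 := en_mulVec (C l) (netVec d C σ x l)
    have h4 := hC l hl'
    have h5 := en_nonneg (netVec d C σ x l)
    have h6 := hρ l hl'
    have h7 := (hs l hl').le
    rw [Finset.prod_range_succ]
    calc _ ≤ ρ l * en ((C l).mulVec (netVec d C σ x l)) := h2
      _ ≤ ρ l * (s l * ((∏ i ∈ Finset.range l, ρ i * s i) * en x)) := by
          gcongr
          exact h3.trans (by gcongr)
      _ = _ := by ring

include hρ hs hσ hσ0 in
theorem net_diff (C C' : ∀ i : ℕ, Matrix (Fin (d (i+1))) (Fin (d i)) ℝ)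
    (hC : ∀ i < L, specNorm (C i) ≤ s i) (hC' : ∀ i < L, specNorm (C' i) ≤ s i)
    (e : ℕ → ℝ) (he : ∀ i < L, 0 ≤ e i)
    (hCC : ∀ i < L, ∀ v, en ((C i - C' i).mulVec v) ≤ e i * en v)
    (x : Fin (d 0) → ℝ) (l : ℕ) (hl : l ≤ L) :
    en (netVec d C σ x l - netVec d C' σ x l) ≤
      (∏ i ∈ Finset.range l, ρ i * s i) * (∑ i ∈ Finset.range l, e i / s i) * en x := by
  induction l with
  | zero => simp [netVec, en]
  | succ l ih =>
    have hl' : l < L := by omega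
    have h1 := ih (by omega)
    have hb := net_bound L d σ ρ s hρ hs hσ hσ0 C' hC' x l (by omega)
    have h2 := sig_lip L d σ ρ hσ l hl' ((C l).mulVec (netVec d C σ x l))
      ((C' l).mulVec (netVec d C' σ x l))
    have hsplit : (C l).mulVec (netVec d C σ x l) - (C' l).mulVec (netVec d C' σ x l) =
        (C l).mulVec (netVec d C σ x l - netVec d C' σ x l) +
          (C l - C' l).mulVec (netVec d C' σ x l) := by
      rw [Matrix.mulVec_sub, Matrix.sub_mulVec]; abel
    rw [hsplit] at h2
    have h3 := en_add ((C l).mulVec (netVec d C σ x l - netVec d C' σ x l))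
      ((C l - C' l).mulVec (netVec d C' σ x l))
    have h4 := en_mulVec (C l) (netVec d C σ x l - netVec d C' σ x l)
    have h5 := hCC l hl' (netVec d C' σ x l)
    have h6 := hρ l hl'
    have h7 := hs l hl'
    have h8 := he l hl'
    have h9 := hC l hl'
    set p := ∏ i ∈ Finset.range l, ρ i * s i with hp
    rw [Finset.prod_range_succ, Finset.sum_range_succ, ← hp]
    set q := ∑ i ∈ Finset.range l, e i / s i
    have n1 := en_nonneg (netVec d C σ x l - netVec d C' σ x l)
    calc _ ≤ ρ l * _ := h2
      _ ≤ ρ l * (s l * (p * q * en x) + e l * (p * en x)) := by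
          gcongr
          refine h3.trans (add_le_add (h4.trans ?_) (h5.trans ?_))
          · gcongr
          · gcongr
      _ = _ := by field_simp

end net

theorem layer_fc (p q : ℕ) (Q : Matrix (Fin p) (Fin q) ℝ → Prop) (a e : ℝ) (ha : 0 ≤ a)
    (he : 0 < e) (hQ : ∀ M, Q M → frobNorm M ≤ a) :
    ∃ N : Finset (Matrix (Fin p) (Fin q) ℝ), (∀ M ∈ N, Q M) ∧
      (N.card : ℝ) ≤ (1 + 2 * (a * 1) / e) ^ (p * q) ∧
      ∀ M, Q M → ∃ M' ∈ N, ∀ v, en ((M - M').mulVec v) ≤ e * en v := by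
  obtain ⟨N, h1, h2, h3⟩ := param_net p q Q a e 1 ha he zero_le_one hQ
  refine ⟨N, h1, h2, fun M hM => ?_⟩
  obtain ⟨M', hM', h⟩ := h3 M hM
  rw [one_mul] at h
  exact ⟨M', hM', fun v => (en_mulVec_frob _ _).trans
    (mul_le_mul_of_nonneg_right h (en_nonneg _))⟩

theorem layer_conv {c r d m d' : ℕ} (S : Fin m → Fin r → Fin d)
    (hS : ∀ k, Function.Injective (S k)) (eq : Fin c × Fin m ≃ Fin d')
    (Q : Matrix (Fin d') (Fin d) ℝ → Prop) (a e : ℝ) (ha : 0 ≤ a)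
    (he : 0 < e) (hQ : ∀ M, Q M → ∃ W : Matrix (Fin c) (Fin r) ℝ, frobNorm W ≤ a ∧
      M = Matrix.reindex eq (Equiv.refl (Fin d)) (gamma S W)) :
    ∃ N : Finset (Matrix (Fin d') (Fin d) ℝ), (∀ M ∈ N, Q M) ∧
      (N.card : ℝ) ≤ (1 + 2 * (a * Real.sqrt m) / e) ^ (c * r) ∧
      ∀ M, Q M → ∃ M' ∈ N, ∀ v, en ((M - M').mulVec v) ≤ e * en v := by
  classical
  obtain ⟨N, h1, h2, h3⟩ := param_net c r
    (fun W => Q (Matrix.reindex eq (Equiv.refl (Fin d)) (gamma S W)) ∧ frobNorm W ≤ a)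
    a e (Real.sqrt m) ha he (Real.sqrt_nonneg _) (fun W hW => hW.2)
  refine ⟨N.image fun W => Matrix.reindex eq (Equiv.refl (Fin d)) (gamma S W), ?_, ?_, ?_⟩
  · intro M hM
    obtain ⟨W, hW, rfl⟩ := Finset.mem_image.1 hM
    exact (h1 W hW).1
  · refine le_trans ?_ h2
    exact_mod_cast Finset.card_image_le
  · intro M hM
    obtain ⟨W, hW, rfl⟩ := hQ M hM
    obtain ⟨W', hW', h⟩ := h3 W ⟨hM, hW⟩
    refine ⟨_, Finset.mem_image_of_mem _ hW', fun v => ?_⟩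
    have h5 : Matrix.reindex eq (Equiv.refl (Fin d)) (gamma S W) -
        Matrix.reindex eq (Equiv.refl (Fin d)) (gamma S W') =
        Matrix.reindex eq (Equiv.refl (Fin d)) (gamma S (W - W')) := by
      rw [gamma_sub]; rfl
    rw [h5]
    exact (en_gamma S hS _ eq v).trans (mul_le_mul_of_nonneg_right h (en_nonneg _))

theorem log_one_add_le_sqrt (x : ℝ) (hx : 0 ≤ x) : Real.log (1 + x) ≤ Real.sqrt x := by
  rw [Real.log_le_iff_le_exp (by linarith)]
  have h := Real.sum_le_exp_of_nonneg (Real.sqrt_nonneg x) 4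
  refine le_trans ?_ h
  have hu := Real.sqrt_nonneg x
  have hsq := Real.sq_sqrt hx
  set u := Real.sqrt x
  simp [Finset.sum_range_succ, Nat.factorial]
  rw [← hsq]
  nlinarith [mul_nonneg hu (sq_nonneg (u - 3/2))]

section cls
variable (L : ℕ) (d : ℕ → ℕ) (σ : ∀ i : ℕ, (Fin (d (i+1)) → ℝ) → (Fin (d (i+1)) → ℝ))
    (ρ s : ℕ → ℝ)
    (hρ : ∀ i < L, 0 ≤ ρ i) (hs : ∀ i < L, 0 < s i)
    (hσ : ∀ i < L, ∀ u v : Fin (d (i+1)) → ℝ,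
      Real.sqrt (∑ j, (σ i u j - σ i v j) ^ 2) ≤ ρ i * Real.sqrt (∑ j, (u j - v j) ^ 2))
    (hσ0 : ∀ i < L, σ i 0 = 0) (η : ℝ) (hη : 0 < η) (n : ℕ)
    (x : Fin n → Fin (d 0) → ℝ) (y : Fin n → Fin (d L))

noncomputable def fvec (C : ∀ i : ℕ, Matrix (Fin (d (i+1))) (Fin (d i)) ℝ) : Fin n → ℝ :=
  fun t => rampLoss η (netVec d C σ (x t) L) (y t)

include hρ hs hσ hσ0 hη in
theorem fvec_diff (C C' : ∀ i : ℕ, Matrix (Fin (d (i+1))) (Fin (d i)) ℝ)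
    (hC : ∀ i < L, specNorm (C i) ≤ s i) (hC' : ∀ i < L, specNorm (C' i) ≤ s i)
    (e : ℕ → ℝ) (he : ∀ i < L, 0 ≤ e i)
    (hCC : ∀ i < L, ∀ v, en ((C i - C' i).mulVec v) ≤ e i * en v) :
    ∑ t, (fvec L d σ η n x y C t - fvec L d σ η n x y C' t) ^ 2 ≤
      ((2 * Real.sqrt (∑ i, ∑ j, (x i j) ^ 2) * (∏ i ∈ Finset.range L, ρ i * s i) / η) *
        ∑ i ∈ Finset.range L, e i / s i) ^ 2 := by
  have h1 : ∀ t, (fvec L d σ η n x y C t - fvec L d σ η n x y C' t) ^ 2 ≤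
      (2 / η * ((∏ i ∈ Finset.range L, ρ i * s i) * ∑ i ∈ Finset.range L, e i / s i)) ^ 2 *
        ∑ j, (x t j) ^ 2 := by
    intro t
    have h2 := rampLoss_lip η hη (netVec d C σ (x t) L) (netVec d C' σ (x t) L) (y t)
    have h3 := net_diff L d σ ρ s hρ hs hσ hσ0 C C' hC hC' e he hCC (x t) L le_rfl
    rw [← en_sq, ← mul_pow, ← sq_abs]
    apply pow_le_pow_left₀ (abs_nonneg _)
    refine h2.trans ?_
    rw [mul_assoc]
    gcongr
  refine (Finset.sum_le_sum fun t _ => h1 t).trans (le_of_eq ?_)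
  rw [← Finset.mul_sum]
  have h4 : (Real.sqrt (∑ i, ∑ j, (x i j) ^ 2)) ^ 2 = ∑ i, ∑ j, (x i j) ^ 2 :=
    Real.sq_sqrt (Finset.sum_nonneg fun _ _ => Finset.sum_nonneg fun _ _ => sq_nonneg _)
  generalize Real.sqrt (∑ i, ∑ j, (x i j) ^ 2) = X at h4 ⊢
  rw [← h4]
  ring

include hρ hs hσ hσ0 hη in
theorem class_net (Q : ∀ i : ℕ, Matrix (Fin (d (i+1))) (Fin (d i)) ℝ → Prop)
    (a κ : ℕ → ℝ) (p : ℕ → ℕ) (ha : ∀ i < L, 0 < a i) (hκ : ∀ i < L, 0 ≤ κ i)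
    (hQs : ∀ i < L, ∀ M, Q i M → specNorm M ≤ s i) (hQ0 : ∀ i < L, Q i 0)
    (hQ : ∀ i < L, ∀ e : ℝ, 0 < e → ∃ N : Finset (Matrix (Fin (d (i+1))) (Fin (d i)) ℝ),
      (∀ M ∈ N, Q i M) ∧ (N.card : ℝ) ≤ (1 + 2 * (a i * κ i) / e) ^ (p i) ∧
      ∀ M, Q i M → ∃ M' ∈ N, ∀ v, en ((M - M').mulVec v) ≤ e * en v) (e : ℝ) (he : 0 < e) :
    ∃ T : Finset (Fin n → ℝ),
      (∀ t ∈ T, t ∈ fvec L d σ η n x y '' {C | ∀ i < L, Q i (C i)}) ∧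
      Real.log T.card ≤ Real.sqrt ((2 * Real.sqrt (∑ i, ∑ j, (x i j) ^ 2) *
        ((2 * ∏ i ∈ Finset.range L, ρ i * s i) *
          (∑ i ∈ Finset.range L, (p i : ℝ) ^ 2 * (a i * κ i) / s i) * (L : ℝ) ^ 2) / η) / e) ∧
      ∀ v ∈ fvec L d σ η n x y '' {C | ∀ i < L, Q i (C i)},
        ∃ t ∈ T, ∑ i, (v i - t i) ^ 2 ≤ e ^ 2 := by
  classical
  set Q0 := 2 * Real.sqrt (∑ i, ∑ j, (x i j) ^ 2) * (∏ i ∈ Finset.range L, ρ i * s i) / η with hQ0d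
  have hprod : 0 ≤ ∏ i ∈ Finset.range L, ρ i * s i := Finset.prod_nonneg fun i hi =>
    mul_nonneg (hρ i (Finset.mem_range.1 hi)) (hs i (Finset.mem_range.1 hi)).le
  have hQ00 : 0 ≤ Q0 := by positivity
  rcases (mul_nonneg hQ00 (Nat.cast_nonneg L : (0 : ℝ) ≤ L)).eq_or_lt with hz | hpos
  · refine ⟨{fvec L d σ η n x y 0}, ?_, ?_, ?_⟩
    · intro t ht
      rw [Finset.mem_singleton] at ht
      exact ⟨0, fun i hi => hQ0 i hi, ht.symm⟩
    · simp
    · rintro _ ⟨C, hC, rfl⟩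
      refine ⟨_, Finset.mem_singleton_self _, ?_⟩
      have := fvec_diff L d σ ρ s hρ hs hσ hσ0 η hη n x y C 0 (fun i hi => hQs i hi _ (hC i hi))
        (fun i hi => hQs i hi _ (hQ0 i hi)) s (fun i hi => (hs i hi).le) (fun i hi v => by
          simp only [Pi.zero_apply, sub_zero]
          exact (en_mulVec _ _).trans
            (mul_le_mul_of_nonneg_right (hQs i hi _ (hC i hi)) (en_nonneg _)))
      refine this.trans ?_
      have h2 : ∑ i ∈ Finset.range L, s i / s i = L := by
        rw [Finset.sum_congr rfl fun i hi => div_self (hs i (Finset.mem_range.1 hi)).ne']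
        simp
      rw [h2, ← hQ0d, ← hz]
      simp; positivity
  have hL : (0 : ℝ) < L := pos_of_mul_pos_right hpos hQ00
  have hQp : 0 < Q0 := pos_of_mul_pos_left hpos hL.le
  have hei : ∀ i < L, 0 < e * s i / (L * Q0) := fun i hi => by
    have := hs i hi; positivity
  choose! N hN1 hN2 hN3 using fun i (hi : i < L) => hQ i hi (e * s i / (L * Q0)) (hei i hi)
  let mk : (∀ i ∈ Finset.range L, Matrix (Fin (d (i+1))) (Fin (d i)) ℝ) →
      ∀ i : ℕ, Matrix (Fin (d (i+1))) (Fin (d i)) ℝ :=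
    fun g i => if h : i ∈ Finset.range L then g i h else 0
  let T := ((Finset.range L).pi N).image fun g => fvec L d σ η n x y (mk g)
  have hmk : ∀ g ∈ (Finset.range L).pi N, ∀ i < L, mk g i ∈ N i := by
    intro g hg i hi
    have hi' := Finset.mem_range.2 hi
    simp only [mk, hi', dif_pos]
    exact Finset.mem_pi.1 hg i hi'
  have hcov : ∀ v ∈ fvec L d σ η n x y '' {C | ∀ i < L, Q i (C i)},
        ∃ t ∈ T, ∑ i, (v i - t i) ^ 2 ≤ e ^ 2 := by
    rintro _ ⟨C, hC, rfl⟩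
    have : ∀ i, ∃ M', i < L → M' ∈ N i ∧ ∀ v, en ((C i - M').mulVec v) ≤ e * s i / (L * Q0) * en v := by
      intro i
      by_cases hi : i < L
      · obtain ⟨M', h1, h2⟩ := hN3 i hi (C i) (hC i hi)
        exact ⟨M', fun _ => ⟨h1, h2⟩⟩
      · exact ⟨0, fun h => absurd h hi⟩
    choose M' hM' using this
    have hg : (fun i (_ : i ∈ Finset.range L) => M' i) ∈ (Finset.range L).pi N :=
      Finset.mem_pi.2 fun i hi => (hM' i (Finset.mem_range.1 hi)).1
    refine ⟨_, Finset.mem_image_of_mem _ hg, ?_⟩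
    have := fvec_diff L d σ ρ s hρ hs hσ hσ0 η hη n x y C
      (mk (fun i (_ : i ∈ Finset.range L) => M' i)) (fun i hi => hQs i hi _ (hC i hi))
      (fun i hi => hQs i hi _ (hN1 i hi _ (hmk _ hg i hi))) (fun i => e * s i / (L * Q0))
      (fun i hi => (hei i hi).le) (fun i hi v => by
        have hi' := Finset.mem_range.2 hi
        simp only [mk, hi', dif_pos]
        exact (hM' i hi).2 v)
    refine this.trans (le_of_eq ?_)
    have h2 : ∑ i ∈ Finset.range L, e * s i / (L * Q0) / s i = e / Q0 := by
      rw [Finset.sum_congr rfl fun i hi => show e * s i / (L * Q0) / s i = e / (L * Q0) by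
        have := (hs i (Finset.mem_range.1 hi)).ne'
        field_simp]
      simp; field_simp
    rw [h2, ← hQ0d]
    field_simp
  refine ⟨T, ?_, ?_, hcov⟩
  · intro t ht
    obtain ⟨g, hg, rfl⟩ := Finset.mem_image.1 ht
    exact ⟨mk g, fun i hi => hN1 i hi _ (hmk g hg i hi), rfl⟩
  · have hTne : T.Nonempty := by
      obtain ⟨t, ht, _⟩ := hcov (fvec L d σ η n x y 0) ⟨0, fun i hi => hQ0 i hi, rfl⟩
      exact ⟨t, ht⟩
    have hBn : ∀ i < L, 0 ≤ 2 * (a i * κ i) / (e * s i / (L * Q0)) := fun i hi => by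
      have := hei i hi; have := ha i hi; have := hκ i hi; positivity
    have hcard : (T.card : ℝ) ≤
        ∏ i ∈ Finset.range L, (1 + 2 * (a i * κ i) / (e * s i / (L * Q0))) ^ (p i) := by
      calc (T.card : ℝ) ≤ (((Finset.range L).pi N).card : ℝ) := by
            exact_mod_cast Finset.card_image_le
        _ = ∏ i ∈ Finset.range L, ((N i).card : ℝ) := by rw [Finset.card_pi]; push_cast; rfl
        _ ≤ _ := Finset.prod_le_prod (fun i _ => by positivity) fun i hi =>
            hN2 i (Finset.mem_range.1 hi)
    have h1 : Real.log T.card ≤ ∑ i ∈ Finset.range L,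
        p i * Real.sqrt (2 * (a i * κ i) / (e * s i / (L * Q0))) := by
      refine (Real.log_le_log (by exact_mod_cast hTne.card_pos) hcard).trans ?_
      rw [Real.log_prod fun i hi => (pow_pos (by
        have := hBn i (Finset.mem_range.1 hi); linarith) _).ne']
      apply Finset.sum_le_sum
      intro i hi
      rw [Real.log_pow]
      gcongr
      exact log_one_add_le_sqrt _ (hBn i (Finset.mem_range.1 hi))
    refine h1.trans ?_
    apply Real.le_sqrt_of_sq_le
    refine (sq_sum_le_card_mul_sum_sq (s := Finset.range L)).trans (le_of_eq ?_)
    have h3 : ∀ i ∈ Finset.range L,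
        (p i * Real.sqrt (2 * (a i * κ i) / (e * s i / (L * Q0)))) ^ 2 =
          2 * L * Q0 / e * ((p i : ℝ) ^ 2 * (a i * κ i) / s i) := by
      intro i hi
      have := (hs i (Finset.mem_range.1 hi)).ne'
      rw [mul_pow, Real.sq_sqrt (hBn i (Finset.mem_range.1 hi))]
      field_simp
    rw [Finset.sum_congr rfl h3, ← Finset.mul_sum, Finset.card_range, hQ0d]
    field_simp

end cls

section fin
open MeasureTheory TopologicalSpace

theorem gen_class (L n : ℕ) (hn : 1 ≤ n) (d : ℕ → ℕ)
    (σ : ∀ i : ℕ, (Fin (d (i+1)) → ℝ) → (Fin (d (i+1)) → ℝ))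
    (ρ s : ℕ → ℝ)
    (hρ : ∀ i < L, 0 ≤ ρ i) (hs : ∀ i < L, 0 < s i)
    (hσ : ∀ i < L, ∀ u v : Fin (d (i+1)) → ℝ,
      Real.sqrt (∑ j, (σ i u j - σ i v j) ^ 2) ≤ ρ i * Real.sqrt (∑ j, (u j - v j) ^ 2))
    (hσ0 : ∀ i < L, σ i 0 = 0) (η : ℝ) (hη : 0 < η)
    (δ : ℝ) (hδ0 : 0 < δ) (hδ1 : δ < 1)
    (D : Measure ((Fin (d 0) → ℝ) × Fin (d L))) [IsProbabilityMeasure D]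
    (Q : ∀ i : ℕ, Matrix (Fin (d (i+1))) (Fin (d i)) ℝ → Prop)
    (a κ : ℕ → ℝ) (p : ℕ → ℕ) (ha : ∀ i < L, 0 < a i) (hκ : ∀ i < L, 0 ≤ κ i)
    (hQs : ∀ i < L, ∀ M, Q i M → specNorm M ≤ s i) (hQ0 : ∀ i < L, Q i 0)
    (hQ : ∀ i < L, ∀ e : ℝ, 0 < e → ∃ N : Finset (Matrix (Fin (d (i+1))) (Fin (d i)) ℝ),
      (∀ M ∈ N, Q i M) ∧ (N.card : ℝ) ≤ (1 + 2 * (a i * κ i) / e) ^ (p i) ∧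
      ∀ M, Q i M → ∃ M' ∈ N, ∀ v, en ((M - M').mulVec v) ≤ e * en v) :
    Measure.pi (fun _ : Fin n => D)
      { S : Fin n → ((Fin (d 0) → ℝ) × Fin (d L)) |
        ∃ C : ∀ i : ℕ, Matrix (Fin (d (i+1))) (Fin (d i)) ℝ, (∀ i < L, Q i (C i)) ∧
          (1 / n : ℝ) * (∑ i, rampLoss η (netVec d C σ ((S i).1) L) ((S i).2)) +
              32 * (2 * Real.sqrt (∑ i, ∑ j, ((S i).1 j) ^ 2) *
                ((2 * ∏ i ∈ Finset.range L, ρ i * s i) *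
                  (∑ i ∈ Finset.range L, (p i : ℝ) ^ 2 * (a i * κ i) / s i) *
                  (L : ℝ) ^ 2) / η) ^ ((1 : ℝ) / 4) * (n : ℝ) ^ (-(5 : ℝ) / 8) +
              3 * Real.sqrt (Real.log (1 / δ) / (2 * n)) <
          (D { z : (Fin (d 0) → ℝ) × Fin (d L) |
                netVec d C σ z.1 L z.2 ≤
                  sSup ((netVec d C σ z.1 L) '' {j | j ≠ z.2}) }).toReal } ≤
      ENNReal.ofReal δ := by
  have hn0 : (0 : ℝ) < n := by exact_mod_cast hn
  let H := {C : ∀ i : ℕ, Fin (d (i+1)) → Fin (d i) → ℝ // ∀ i < L, Q i (C i)}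
  let F : H → ((Fin (d 0) → ℝ) × Fin (d L)) → ℝ := fun C z =>
    rampLoss η (netVec d C.1 σ z.1 L) z.2
  have hF0 : ∀ C z, 0 ≤ F C z := fun C z => rampLoss_nonneg η hη _ _
  have hF1 : ∀ C z, F C z ≤ 1 := fun C z => rampLoss_le_one η hη _ _
  have hFa : ∀ C z, |F C z| ≤ 1 := fun C z =>
    abs_le.2 ⟨by linarith [hF0 C z], hF1 C z⟩
  have hFm : ∀ C, Measurable (F C) := by
    intro C
    apply measurable_from_prod_countable_left
    intro y
    have : Continuous fun x : Fin (d 0) → ℝ => netVec d C.1 σ x L :=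
      net_cont L d σ ρ hσ (fun _ => C.1) (fun x => x) continuous_const continuous_id L le_rfl
    exact ((rampLoss_cont η hη y).comp this).measurable
  have hFc : ∀ z, Continuous fun C => F C z := by
    intro z
    have : Continuous fun C : H => netVec d C.1 σ z.1 L :=
      net_cont L d σ ρ hσ (fun C : H => C.1) (fun _ => z.1) continuous_subtype_val
        continuous_const L le_rfl
    exact (rampLoss_cont η hη z.2).comp this
  have hsc : SecondCountableTopology H :=
    TopologicalSpace.Subtype.secondCountableTopology
      {C : ∀ i : ℕ, Fin (d (i+1)) → Fin (d i) → ℝ | ∀ i < L, Q i (C i)}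
  have hIc : Continuous fun C => ∫ z, F C z ∂D := by
    apply continuous_of_dominated (bound := fun _ => 1)
    · intro C; exact (hFm C).aestronglyMeasurable
    · intro C; exact Filter.Eventually.of_forall fun z => by
        rw [Real.norm_eq_abs]; exact hFa C z
    · exact integrable_const _
    · exact Filter.Eventually.of_forall hFc
  have : Nonempty H := ⟨⟨0, fun i hi => hQ0 i hi⟩⟩
  obtain ⟨U, hUc, hUd⟩ := TopologicalSpace.exists_countable_dense H
  have : Countable U := hUc.to_subtype
  have : Nonempty U := hUd.nonempty.to_subtype
  refine le_trans (measure_mono ?_) (gen_abstract D (fun q : U => F q.1) (fun q => hFm q.1)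
    (fun q z => hF0 q.1 z) (fun q z => hF1 q.1 z) n hn δ hδ0 hδ1)
  rintro S ⟨C, hC, hlt⟩
  set K := (2 * Real.sqrt (∑ i, ∑ j, ((S i).1 j) ^ 2) *
                ((2 * ∏ i ∈ Finset.range L, ρ i * s i) *
                  (∑ i ∈ Finset.range L, (p i : ℝ) ^ 2 * (a i * κ i) / s i) *
                  (L : ℝ) ^ 2) / η) with hKd
  have hK : 0 ≤ K := by
    have h1 : 0 ≤ ∏ i ∈ Finset.range L, ρ i * s i := Finset.prod_nonneg fun i hi =>
      mul_nonneg (hρ i (Finset.mem_range.1 hi)) (hs i (Finset.mem_range.1 hi)).le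
    have h2 : 0 ≤ ∑ i ∈ Finset.range L, (p i : ℝ) ^ 2 * (a i * κ i) / s i :=
      Finset.sum_nonneg fun i hi => by
        have := hs i (Finset.mem_range.1 hi)
        have := ha i (Finset.mem_range.1 hi)
        have := hκ i (Finset.mem_range.1 hi)
        positivity
    positivity
  have hrad : 2 * radS (fun q : U => F q.1) n S / n ≤
      32 * K ^ ((1 : ℝ) / 4) * (n : ℝ) ^ (-(5 : ℝ) / 8) := by
    let fv := fvec L d σ η n (fun i => (S i).1) (fun i => (S i).2)
    let V : Set (Fin n → ℝ) := fv '' {C | ∀ i < L, Q i (C i)}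
    have hV01 : ∀ v ∈ V, ∀ i, 0 ≤ v i ∧ v i ≤ 1 := by
      rintro _ ⟨C, hC, rfl⟩ i
      exact ⟨rampLoss_nonneg η hη _ _, rampLoss_le_one η hη _ _⟩
    have hd := dudley hn V ⟨_, 0, fun i hi => hQ0 i hi, rfl⟩ hV01 K hK (fun e he =>
      class_net L d σ ρ s hρ hs hσ hσ0 η hη n (fun i => (S i).1) (fun i => (S i).2) Q a κ p ha hκ
        hQs hQ0 hQ e he)
    have h1 : radS (fun q : U => F q.1) n S ≤ ravg (fun ε => sSup (rdot ε '' V)) := by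
      apply ravg_mono
      intro ε
      apply ciSup_le
      intro q
      apply le_csSup
      · refine ⟨n, ?_⟩
        rintro _ ⟨v, hv, rfl⟩
        exact (abs_le.1 (abs_rdot_le ε v fun i =>
          abs_le.2 ⟨by linarith [(hV01 v hv i).1], (hV01 v hv i).2⟩)).2
      · exact ⟨_, ⟨q.1.1, q.1.2, rfl⟩, rfl⟩
    have h2 : (n : ℝ) ^ (-(5 : ℝ) / 8) = (n : ℝ) ^ ((3 : ℝ) / 8) / n := by
      rw [show (-(5 : ℝ) / 8) = 3 / 8 - 1 by norm_num, Real.rpow_sub_one hn0.ne']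
    rw [h2, ← mul_div_assoc]
    apply div_le_div_of_nonneg_right _ hn0.le
    linarith
  have hI : (D { z : (Fin (d 0) → ℝ) × Fin (d L) | netVec d C σ z.1 L z.2 ≤
      sSup ((netVec d C σ z.1 L) '' {j | j ≠ z.2}) }).toReal ≤ ∫ z, F ⟨C, hC⟩ z ∂D := by
    have hint : Integrable (F ⟨C, hC⟩) D := Integrable.of_bound
      (hFm _).aestronglyMeasurable 1 (Filter.Eventually.of_forall fun z => by
        rw [Real.norm_eq_abs]; exact hFa _ z)
    have h1 : D { z : (Fin (d 0) → ℝ) × Fin (d L) | netVec d C σ z.1 L z.2 ≤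
      sSup ((netVec d C σ z.1 L) '' {j | j ≠ z.2}) } ≤ D {z | 1 ≤ F ⟨C, hC⟩ z} :=
      measure_mono fun z hz => (rampLoss_eq_one η hη _ _ hz).ge
    have h2 := mul_meas_ge_le_integral_of_nonneg (μ := D)
      (Filter.Eventually.of_forall fun z => hF0 ⟨C, hC⟩ z) hint 1
    rw [one_mul] at h2
    exact (ENNReal.toReal_mono (measure_ne_top _ _) h1).trans h2
  have hEc : Continuous fun C : H => (1 / n : ℝ) * (∑ i, F C (S i)) +
      2 * radS (fun q : U => F q.1) n S / n + 3 * Real.sqrt (Real.log (1 / δ) / (2 * n)) :=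
    ((continuous_const.mul (continuous_finsetSum _ fun i _ => hFc (S i))).add
      continuous_const).add continuous_const
  have hopen := isOpen_lt hEc hIc
  obtain ⟨C', hC', hC'U⟩ := hUd.inter_open_nonempty _ hopen ⟨⟨C, hC⟩, by
    have : (1 / n : ℝ) * (∑ i, F ⟨C, hC⟩ (S i)) =
      (1 / n : ℝ) * (∑ i, rampLoss η (netVec d C σ ((S i).1) L) ((S i).2)) := rfl
    rw [Set.mem_setOf_eq, this]
    linarith⟩
  exact ⟨⟨C', hC'U⟩, hC'⟩

end fin

/-- generalization bound for CNNs: with probability at least `1 − δ` over an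
i.i.d. sample of size `n` from `D`, every network `h_C` in the class satisfies
`D(misclassification) ≤ empirical ramp loss + 32·(2‖X‖_F R_C/η)^{1/4} n^{−5/8}
  + 3√(ln(1/δ)/(2n))`; i.e. the outer probability of the set of samples where some `h_C`
violates this inequality is at most `δ`. -/
theorem generalization_bound_cnn (L n : ℕ) (hn : 1 ≤ n) (d c r m : ℕ → ℕ)
    (SA SW : Finset ℕ) (hpart : SA ∪ SW = Finset.range L) (hdisj : Disjoint SA SW)
    (hd : ∀ i ∈ SW, d (i+1) = c i * m i)
    (Smap : ∀ i : ℕ, Fin (m i) → Fin (r i) → Fin (d i))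
    (hSmap : ∀ i ∈ SW, ∀ k, Function.Injective (Smap i k))
    (σ : ∀ i : ℕ, (Fin (d (i+1)) → ℝ) → (Fin (d (i+1)) → ℝ))
    (ρ s a : ℕ → ℝ)
    (hρ : ∀ i < L, 0 ≤ ρ i) (hs : ∀ i < L, 0 < s i) (ha : ∀ i < L, 0 < a i)
    (hσ : ∀ i < L, ∀ u v : Fin (d (i+1)) → ℝ,
      Real.sqrt (∑ j, (σ i u j - σ i v j) ^ 2) ≤ ρ i * Real.sqrt (∑ j, (u j - v j) ^ 2))
    (hσ0 : ∀ i < L, σ i 0 = 0)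
    (η : ℝ) (hη : 0 < η) (δ : ℝ) (hδ0 : 0 < δ) (hδ1 : δ < 1)
    (D : MeasureTheory.Measure ((Fin (d 0) → ℝ) × Fin (d L)))
    [MeasureTheory.IsProbabilityMeasure D] :
    MeasureTheory.Measure.pi (fun _ : Fin n => D)
      { S : Fin n → ((Fin (d 0) → ℝ) × Fin (d L)) |
        ∃ C : ∀ i : ℕ, Matrix (Fin (d (i+1))) (Fin (d i)) ℝ,
          ((∀ i < L, specNorm (C i) ≤ s i) ∧
           (∀ i ∈ SA, frobNorm (C i) ≤ a i) ∧
           (∀ i (hi : i ∈ SW), ∃ W : Matrix (Fin (c i)) (Fin (r i)) ℝ, frobNorm W ≤ a i ∧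
              C i = Matrix.reindex (finProdFinEquiv.trans (finCongr (hd i hi).symm))
                (Equiv.refl (Fin (d i))) (gamma (Smap i) W))) ∧
          ¬ ((D { z : (Fin (d 0) → ℝ) × Fin (d L) |
                netVec d C σ z.1 L z.2 ≤
                  sSup ((netVec d C σ z.1 L) '' {j | j ≠ z.2}) }).toReal ≤
              (1 / n : ℝ) * (∑ i, rampLoss η (netVec d C σ ((S i).1) L) ((S i).2)) +
              32 * (2 * Real.sqrt (∑ i, ∑ j, ((S i).1 j) ^ 2) *
                ((2 * ∏ i ∈ Finset.range L, ρ i * s i) *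
                  ((∑ i ∈ SA, (d (i+1) : ℝ) ^ 2 * (d i : ℝ) ^ 2 * a i / s i) +
                   (∑ i ∈ SW, (c i : ℝ) ^ 2 * (r i : ℝ) ^ 2 * a i *
                      Real.sqrt ((d (i+1) : ℝ) / (c i : ℝ)) / s i)) *
                  (L : ℝ) ^ 2) / η) ^ ((1 : ℝ) / 4) * (n : ℝ) ^ (-(5 : ℝ) / 8) +
              3 * Real.sqrt (Real.log (1 / δ) / (2 * n))) } ≤
      ENNReal.ofReal δ := by
  classical
  have hSA : ∀ i ∈ SA, i < L := fun i hi =>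
    Finset.mem_range.1 (hpart ▸ Finset.mem_union_left _ hi)
  have hSW : ∀ i ∈ SW, i < L := fun i hi =>
    Finset.mem_range.1 (hpart ▸ Finset.mem_union_right _ hi)
  have hor : ∀ i < L, i ∈ SA ∨ i ∈ SW := fun i hi =>
    Finset.mem_union.1 (hpart.symm ▸ Finset.mem_range.2 hi)
  have hnot : ∀ i ∈ SW, i ∉ SA := fun i hi h => Finset.disjoint_left.1 hdisj h hi
  let Q : ∀ i : ℕ, Matrix (Fin (d (i+1))) (Fin (d i)) ℝ → Prop := fun i M =>
    specNorm M ≤ s i ∧ (i ∈ SA → frobNorm M ≤ a i) ∧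
    (∀ hi : i ∈ SW, ∃ W : Matrix (Fin (c i)) (Fin (r i)) ℝ, frobNorm W ≤ a i ∧
      M = Matrix.reindex (finProdFinEquiv.trans (finCongr (hd i hi).symm))
                (Equiv.refl (Fin (d i))) (gamma (Smap i) W))
  let p : ℕ → ℕ := fun i => if i ∈ SA then d (i+1) * d i else c i * r i
  let κ : ℕ → ℝ := fun i => if i ∈ SA then 1 else Real.sqrt (m i)
  have hκ : ∀ i < L, 0 ≤ κ i := by
    intro i _
    simp only [κ]
    split_ifs
    · exact zero_le_one
    · exact Real.sqrt_nonneg _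
  have hQ0 : ∀ i < L, Q i 0 := by
    intro i hi
    refine ⟨?_, fun _ => ?_, fun hi' => ⟨0, ?_, ?_⟩⟩
    · have : specNorm (0 : Matrix (Fin (d (i+1))) (Fin (d i)) ℝ) = 0 := by simp [specNorm]
      rw [this]; exact (hs i hi).le
    · have : frobNorm (0 : Matrix (Fin (d (i+1))) (Fin (d i)) ℝ) = 0 := by simp [frobNorm]
      rw [this]; exact (ha i hi).le
    · have : frobNorm (0 : Matrix (Fin (c i)) (Fin (r i)) ℝ) = 0 := by simp [frobNorm]
      rw [this]; exact (ha i hi).le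
    · ext u v
      simp [gamma]
  have hQ : ∀ i < L, ∀ e : ℝ, 0 < e → ∃ N : Finset (Matrix (Fin (d (i+1))) (Fin (d i)) ℝ),
      (∀ M ∈ N, Q i M) ∧ (N.card : ℝ) ≤ (1 + 2 * (a i * κ i) / e) ^ (p i) ∧
      ∀ M, Q i M → ∃ M' ∈ N, ∀ v, en ((M - M').mulVec v) ≤ e * en v := by
    intro i hi e he
    rcases hor i hi with h | h
    · simp only [p, κ, if_pos h]
      exact layer_fc _ _ (Q i) (a i) e (ha i hi).le he (fun M hM => hM.2.1 h)
    · simp only [p, κ, if_neg (hnot i h)]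
      exact layer_conv (Smap i) (hSmap i h) _ (Q i) (a i) e (ha i hi).le he
        (fun M hM => hM.2.2 h)
  have hsum : ∑ i ∈ Finset.range L, (p i : ℝ) ^ 2 * (a i * κ i) / s i =
      (∑ i ∈ SA, (d (i+1) : ℝ) ^ 2 * (d i : ℝ) ^ 2 * a i / s i) +
                   (∑ i ∈ SW, (c i : ℝ) ^ 2 * (r i : ℝ) ^ 2 * a i *
                      Real.sqrt ((d (i+1) : ℝ) / (c i : ℝ)) / s i) := by
    rw [← hpart, Finset.sum_union hdisj]
    congr 1
    · apply Finset.sum_congr rfl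
      intro i hi
      simp only [p, κ, if_pos hi]
      push_cast; ring
    · apply Finset.sum_congr rfl
      intro i hi
      simp only [p, κ, if_neg (hnot i hi)]
      rw [hd i hi]
      rcases Nat.eq_zero_or_pos (c i) with h | h
      · simp [h]
      · have hc : (c i : ℝ) ≠ 0 := by positivity
        push_cast
        rw [mul_div_cancel_left₀ _ hc]
        ring
  refine le_trans (MeasureTheory.measure_mono ?_) (gen_class L n hn d σ ρ s hρ hs hσ hσ0 η hη
    δ hδ0 hδ1 D Q a κ p ha hκ (fun i _ M hM => hM.1) hQ0 hQ)
  rintro S ⟨C, ⟨h1, h2, h3⟩, h4⟩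
  refine ⟨C, fun i hi => ⟨h1 i hi, fun h => h2 i h, fun h => h3 i h⟩, ?_⟩
  rw [hsum]
  exact not_le.1 h4
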